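/- (Ursell–Young: priority is a total relation.) Let ζ ∈ ∂𝔻 and suppose z and w belong to the same wing of ζ (either both z, w ∈ I⁺(ζ), or both z, w ∈ I⁻(ζ)). Then, in that wing, z has priority over w or w has priority over z. -/

import Mathlib

open Filter Topology Metric Set OnePoint

noncomputable section

local notation "ℂ∞" => OnePoint ℂ

/-- A set `K` is locally connected (connected im kleinen) at a point `z`:
every neighborhood of `z` in `K` contains a connected neighborhood of `z` in `K`. -/
def LocallyConnectedAt {X : Type*} [TopologicalSpace X] (K : Set X) (z : X) : Prop :=
  ∀ V ∈ 𝓝[K] z, ∃ N ∈ 𝓝[K] z, N ⊆ K ∩ V ∧ IsConnected N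

/-- `φ : ℂ → ℂ∞` is holomorphic, as a map into the Riemann sphere, on `D`:
near every point of `D` it is either given by an analytic `ℂ`-valued function, or by the
reciprocal of one. -/
def HolomorphicIntoSphereOn (φ : ℂ → ℂ∞) (D : Set ℂ) : Prop :=
  ∀ z ∈ D,
    (∃ g : ℂ → ℂ, AnalyticAt ℂ g z ∧ ∀ᶠ w in 𝓝 z, φ w = ((g w : ℂ) : ℂ∞)) ∨
    (∃ g : ℂ → ℂ, AnalyticAt ℂ g z ∧
      ∀ᶠ w in 𝓝 z, φ w = if g w = 0 then (∞ : ℂ∞) else (((g w)⁻¹ : ℂ) : ℂ∞))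

/-- The impression of the prime end `ζ ∈ ∂𝔻` (cluster set of `φ` at `ζ`). -/
def impression (φ : ℂ → ℂ∞) (ζ : ℂ) : Set ℂ∞ :=
  {z | ∃ w : ℕ → ℂ, (∀ j, w j ∈ ball (0 : ℂ) 1) ∧ Tendsto w atTop (𝓝 ζ) ∧
    Tendsto (fun j => φ (w j)) atTop (𝓝 z)}

/-- The set of principal points of the prime end `ζ` (radial cluster set of `φ` at `ζ`). -/
def principalPoints (φ : ℂ → ℂ∞) (ζ : ℂ) : Set ℂ∞ :=
  {z | ∃ t : ℕ → ℝ, (∀ j, t j ∈ Ico (0 : ℝ) 1) ∧ Tendsto t atTop (𝓝 1) ∧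
    Tendsto (fun j => φ ((t j : ℂ) * ζ)) atTop (𝓝 z)}

/-- The accumulation set of a curve `Γ : [0,∞) → ℂ∞`: all limits of sequences `Γ (t j)`
with `t j → ∞`. -/
def accSet (Γ : ℝ → ℂ∞) : Set ℂ∞ :=
  {z | ∃ t : ℕ → ℝ, Tendsto t atTop atTop ∧ Tendsto (fun j => Γ (t j)) atTop (𝓝 z)}

/-- `Γ` is a (continuous) curve `[0,∞) → U`. -/
def IsCurveIn (U : Set ℂ∞) (Γ : ℝ → ℂ∞) : Prop :=
  ContinuousOn Γ (Ici 0) ∧ MapsTo Γ (Ici 0) U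

/-- The curve `Γ : [0,∞) → U` converges to the prime end `ζ`: `φ⁻¹(Γ(t)) = ψ(Γ(t)) → ζ`. -/
def ConvergesToPrimeEnd (U : Set ℂ∞) (ψ : ℂ∞ → ℂ) (Γ : ℝ → ℂ∞) (ζ : ℂ) : Prop :=
  IsCurveIn U Γ ∧ Tendsto (fun t => ψ (Γ t)) atTop (𝓝 ζ)

/-- `Γ` converges to the prime end `ζ` from the left. -/
def ConvergesFromLeft (U : Set ℂ∞) (ψ : ℂ∞ → ℂ) (Γ : ℝ → ℂ∞) (ζ : ℂ) : Prop :=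
  ConvergesToPrimeEnd U ψ Γ ζ ∧ ∀ᶠ t in atTop, 0 ≤ (ψ (Γ t) / ζ).im

/-- `Γ` converges to the prime end `ζ` from the right. -/
def ConvergesFromRight (U : Set ℂ∞) (ψ : ℂ∞ → ℂ) (Γ : ℝ → ℂ∞) (ζ : ℂ) : Prop :=
  ConvergesToPrimeEnd U ψ Γ ζ ∧ ∀ᶠ t in atTop, (ψ (Γ t) / ζ).im ≤ 0

/-- The left wing `I⁺(ζ)` of the prime end `ζ`. -/
def leftWing (U : Set ℂ∞) (ψ : ℂ∞ → ℂ) (ζ : ℂ) : Set ℂ∞ :=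
  {z | ∃ Γ : ℝ → ℂ∞, ConvergesFromLeft U ψ Γ ζ ∧ z ∈ accSet Γ}

/-- The right wing `I⁻(ζ)` of the prime end `ζ`. -/
def rightWing (U : Set ℂ∞) (ψ : ℂ∞ → ℂ) (ζ : ℂ) : Set ℂ∞ :=
  {z | ∃ Γ : ℝ → ℂ∞, ConvergesFromRight U ψ Γ ζ ∧ z ∈ accSet Γ}

/-- `z` has priority over `w` in the left wing of `ζ`. -/
def PriorityLeft (U : Set ℂ∞) (ψ : ℂ∞ → ℂ) (ζ : ℂ) (z w : ℂ∞) : Prop :=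
  ∀ Γ : ℝ → ℂ∞, ConvergesFromLeft U ψ Γ ζ → w ∈ accSet Γ → z ∈ accSet Γ

/-- `z` has priority over `w` in the right wing of `ζ`. -/
def PriorityRight (U : Set ℂ∞) (ψ : ℂ∞ → ℂ) (ζ : ℂ) (z w : ℂ∞) : Prop :=
  ∀ Γ : ℝ → ℂ∞, ConvergesFromRight U ψ Γ ζ → w ∈ accSet Γ → z ∈ accSet Γ

/-- The sequence `w` accumulates at `z` (some subsequence converges to `z`). -/
def SeqAccumAt (w : ℕ → ℂ∞) (z : ℂ∞) : Prop :=
  ∃ n : ℕ → ℕ, StrictMono n ∧ Tendsto (fun j => w (n j)) atTop (𝓝 z)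

/-- `z₀` is strongly minimal in the prime end `ζ`: every sequence in `U` converging to the
prime end `ζ` and not accumulating at `z₀` lies on a curve converging to `ζ` whose
accumulation set misses `z₀`. -/
def StronglyMinimal (U : Set ℂ∞) (ψ : ℂ∞ → ℂ) (ζ : ℂ) (z₀ : ℂ∞) : Prop :=
  ∀ w : ℕ → ℂ∞, (∀ j, w j ∈ U) → Tendsto (fun j => ψ (w j)) atTop (𝓝 ζ) →
    ¬ SeqAccumAt w z₀ →
    ∃ Γ : ℝ → ℂ∞, ConvergesToPrimeEnd U ψ Γ ζ ∧ (∀ j, ∃ t, 0 ≤ t ∧ Γ t = w j) ∧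
      z₀ ∉ accSet Γ


theorem exists_clog {A : Type*} [TopologicalSpace A] [SimplyConnectedSpace A]
    [LocallyPathConnectedSpace A] (f : A → ℂ) (hf : Continuous f) (h0 : ∀ a, f a ≠ 0) :
    ∃ g : A → ℂ, Continuous g ∧ ∀ a, Complex.exp (g a) = f a := by
  have : Nonempty A := inferInstance
  obtain ⟨a0⟩ := this
  let F : C(A, {z : ℂ // z ≠ 0}) := ⟨fun a => ⟨f a, h0 a⟩, by fun_prop⟩
  obtain ⟨g, ⟨-, hg⟩, -⟩ := Complex.isCoveringMap_exp.existsUnique_continuousMap_lifts F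
    a0 (Complex.log (f a0)) (by
      apply Subtype.ext
      simpa [F] using Complex.exp_log (h0 a0))
  refine ⟨g, g.continuous, fun a => ?_⟩
  have := congrFun hg a
  simpa [F] using congrArg Subtype.val this

theorem log_diff_const (Θ f : unitInterval → ℂ) (hΘ : Continuous Θ) (hf : Continuous f)
    (h : ∀ t, Complex.exp (Θ t) = f t) (hs : ∀ t, f t ∈ Complex.slitPlane) :
    Θ 1 - Θ 0 = Complex.log (f 1) - Complex.log (f 0) := by
  have key : ∀ t, ∃ n : ℤ, Θ t = Complex.log (f t) + n * (2 * Real.pi * Complex.I) := fun t => by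
    rw [← Complex.exp_eq_exp_iff_exists_int, h, Complex.exp_log (Complex.slitPlane_ne_zero (hs t))]
  choose n hn using key
  have hc : Continuous fun t => (Θ t - Complex.log (f t)) := hΘ.sub (hf.clog hs)
  have hc2 : Continuous fun t => ((n t : ℤ) : ℝ) := by
    have : (fun t => ((n t : ℤ) : ℝ)) = fun t => (Θ t - Complex.log (f t)).im / (2 * Real.pi) := by
      funext t
      rw [hn t]
      simp
    rw [this]
    exact (Complex.continuous_im.comp hc).div_const _
  have hc3 : Continuous n := by
    exact Int.isClosedEmbedding_coe_real.isEmbedding.continuous_iff.2 hc2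
  have : n 1 = n 0 := PreconnectedSpace.constant inferInstance hc3
  rw [hn 1, hn 0, this]
  ring

theorem crossing {N : ℝ} (α β : unitInterval → ℂ) (hα : Continuous α) (hβ : Continuous β)
    (hαN : ∀ t, |(α t).re| ≤ N) (hβN : ∀ t, |(β t).re| ≤ N)
    (a0 : (α 0).re = -N) (a1 : (α 1).re = N) (b0 : (β 0).re = -N) (b1 : (β 1).re = N)
    (h0 : (α 0).im < (β 0).im) (h1 : (β 1).im < (α 1).im) : ∃ s t, α s = β t := by
  by_contra! hne
  obtain ⟨Θ', hΘ', hexp'⟩ := exists_clog (A := ℝ × ℝ)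
    (fun p => α (projIcc 0 1 zero_le_one p.1) - β (projIcc 0 1 zero_le_one p.2))
    ((hα.comp (continuous_projIcc.comp continuous_fst)).sub
      (hβ.comp (continuous_projIcc.comp continuous_snd))) (fun p => sub_ne_zero.2 (hne _ _))
  obtain ⟨Θ, hΘ, hexp⟩ : ∃ Θ : unitInterval × unitInterval → ℂ, Continuous Θ ∧
      ∀ p, Complex.exp (Θ p) = α p.1 - β p.2 := by
    refine ⟨fun p => Θ' (p.1, p.2), by fun_prop, fun p => ?_⟩
    rw [hexp']
    simp
  clear hexp'
  have slit : ∀ x : ℂ, 0 ≤ x.re → x ≠ 0 → x ∈ Complex.slitPlane := fun x hx h => by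
    rw [Complex.mem_slitPlane_iff]
    by_contra! hh
    exact h (Complex.ext (by simpa using le_antisymm hh.1 hx) (by simpa using hh.2))
  have e1 := log_diff_const (fun t => Θ (t, 0)) (fun t => α t - β 0) (by fun_prop) (by fun_prop)
    (fun t => hexp _) (fun t => slit _ (by
      have := abs_le.1 (hαN t); simp; linarith) (sub_ne_zero.2 (hne _ _)))
  have e2 := log_diff_const (fun t => Θ (1, t)) (fun t => α 1 - β t) (by fun_prop) (by fun_prop)
    (fun t => hexp _) (fun t => slit _ (by
      have := abs_le.1 (hβN t); simp; linarith) (sub_ne_zero.2 (hne _ _)))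
  have hexp' : ∀ p, Complex.exp (Θ p + Real.pi * Complex.I) = β p.2 - α p.1 := fun p => by
    rw [Complex.exp_add, hexp, Complex.exp_pi_mul_I]; ring
  have e3 := log_diff_const (fun t => Θ (0, t) + Real.pi * Complex.I) (fun t => β t - α 0)
    (by fun_prop) (by fun_prop)
    (fun t => hexp' _) (fun t => slit _ (by
      have := abs_le.1 (hβN t); simp; linarith) (sub_ne_zero.2 (hne _ _).symm))
  have e4 := log_diff_const (fun t => Θ (t, 1) + Real.pi * Complex.I) (fun t => β 1 - α t)
    (by fun_prop) (by fun_prop)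
    (fun t => hexp' _) (fun t => slit _ (by
      have := abs_le.1 (hαN t); simp; linarith) (sub_ne_zero.2 (hne _ _).symm))
  have e : (Complex.log (α 1 - β 1)).im - (Complex.log (α 0 - β 0)).im =
      (Complex.log (β 1 - α 1)).im - (Complex.log (β 0 - α 0)).im := by
    have q1 := congrArg Complex.im e1
    have q2 := congrArg Complex.im e2
    have q3 := congrArg Complex.im e3
    have q4 := congrArg Complex.im e4
    simp only [Complex.sub_im, Complex.add_im] at q1 q2 q3 q4
    linarith
  have r1 : α 1 - β 1 = ((α 1).im - (β 1).im : ℝ) * Complex.I := by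
    apply Complex.ext <;> simp [a1, b1]
  have r2 : α 0 - β 0 = ((α 0).im - (β 0).im : ℝ) * Complex.I := by
    apply Complex.ext <;> simp [a0, b0]
  have r3 : β 1 - α 1 = ((β 1).im - (α 1).im : ℝ) * Complex.I := by
    apply Complex.ext <;> simp [a1, b1]
  have r4 : β 0 - α 0 = ((β 0).im - (α 0).im : ℝ) * Complex.I := by
    apply Complex.ext <;> simp [a0, b0]
  simp only [Complex.log_im] at e
  rw [Complex.arg_eq_pi_div_two_iff.2 (by rw [r1]; simp; linarith),
    Complex.arg_eq_neg_pi_div_two_iff.2 (by rw [r2]; simp; linarith),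
    Complex.arg_eq_neg_pi_div_two_iff.2 (by rw [r3]; simp; linarith),
    Complex.arg_eq_pi_div_two_iff.2 (by rw [r4]; simp; linarith)] at e
  linarith [Real.pi_pos]

theorem crossing_pc {N : ℝ} {X Y : Set ℂ} (hX : IsPathConnected X) (hY : IsPathConnected Y)
    (hXN : ∀ p ∈ X, |p.re| ≤ N) (hYN : ∀ p ∈ Y, |p.re| ≤ N) (hXY : Disjoint X Y)
    {l r l' r' : ℂ} (hl : l ∈ X) (hr : r ∈ X) (hl' : l' ∈ Y) (hr' : r' ∈ Y)
    (a0 : l.re = -N) (a1 : r.re = N) (b0 : l'.re = -N) (b1 : r'.re = N)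
    (h0 : l.im < l'.im) (h1 : r'.im < r.im) : False := by
  obtain ⟨α, hα⟩ := hX.joinedIn l hl r hr
  obtain ⟨β, hβ⟩ := hY.joinedIn l' hl' r' hr'
  obtain ⟨s, t, hst⟩ := crossing (N := N) α β α.continuous β.continuous (fun t => hXN _ (hα t))
    (fun t => hYN _ (hβ t)) (by simpa) (by simpa) (by simpa) (by simpa) (by simpa) (by simpa)
  exact Set.disjoint_left.1 hXY (hα s) (hst ▸ hβ t)

theorem crossing_mid {N : ℝ} {X Y : Set ℂ} (hX : IsPathConnected X) (hY : IsPathConnected Y)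
    (hXN : ∀ p ∈ X, |p.re| ≤ N) (hYN : ∀ p ∈ Y, |p.re| ≤ N) (hXY : Disjoint X Y)
    {l r l1 l2 r' : ℂ} (hl : l ∈ X) (hr : r ∈ X) (hl1 : l1 ∈ Y) (hl2 : l2 ∈ Y) (hr' : r' ∈ Y)
    (a0 : l.re = -N) (a1 : r.re = N) (b0 : l1.re = -N) (b0' : l2.re = -N) (b1 : r'.re = N)
    (h0 : l1.im < l.im) (h1 : l.im < l2.im) : False := by
  rcases lt_trichotomy r'.im r.im with h | h | h
  · exact crossing_pc hX hY hXN hYN hXY hl hr hl2 hr' a0 a1 b0' b1 h1 h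
  · have : r' = r := Complex.ext (by rw [a1, b1]) h
    exact Set.disjoint_left.1 hXY hr (this ▸ hr')
  · exact crossing_pc hY hX hYN hXN hXY.symm hl1 hr' hl hr b0 b1 a0 a1 h0 h

theorem three_crossing {N : ℝ} {X1 X2 X3 Y12 Y23 Y13 : Set ℂ}
    (hX1 : IsPathConnected X1) (hX2 : IsPathConnected X2) (hX3 : IsPathConnected X3)
    (hY12 : IsPathConnected Y12) (hY23 : IsPathConnected Y23) (hY13 : IsPathConnected Y13)
    (s1 : X1 ⊆ Y12) (s2 : X2 ⊆ Y12) (s3 : X2 ⊆ Y23) (s4 : X3 ⊆ Y23) (s5 : X1 ⊆ Y13)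
    (s6 : X3 ⊆ Y13)
    (n12 : ∀ p ∈ Y12, |p.re| ≤ N) (n23 : ∀ p ∈ Y23, |p.re| ≤ N) (n13 : ∀ p ∈ Y13, |p.re| ≤ N)
    (d1 : Disjoint X1 Y23) (d2 : Disjoint X2 Y13) (d3 : Disjoint X3 Y12)
    (l1 : ∃ p ∈ X1, p.re = -N) (l2 : ∃ p ∈ X2, p.re = -N) (l3 : ∃ p ∈ X3, p.re = -N)
    (r1 : ∃ p ∈ X1, p.re = N) (r2 : ∃ p ∈ X2, p.re = N) (r3 : ∃ p ∈ X3, p.re = N) : False := by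
  obtain ⟨l1, hl1, el1⟩ := l1
  obtain ⟨l2, hl2, el2⟩ := l2
  obtain ⟨l3, hl3, el3⟩ := l3
  obtain ⟨r1, hr1, er1⟩ := r1
  obtain ⟨r2, hr2, er2⟩ := r2
  obtain ⟨r3, hr3, er3⟩ := r3
  have n12' : l1.im ≠ l2.im := fun h => by
    have : l1 = l2 := Complex.ext (by rw [el1, el2]) h
    exact Set.disjoint_left.1 d1 hl1 (s3 (this ▸ hl2))
  have n13' : l1.im ≠ l3.im := fun h => by
    have : l1 = l3 := Complex.ext (by rw [el1, el3]) h
    exact Set.disjoint_left.1 d1 hl1 (s4 (this ▸ hl3))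
  have n23' : l2.im ≠ l3.im := fun h => by
    have : l2 = l3 := Complex.ext (by rw [el2, el3]) h
    exact Set.disjoint_left.1 d2 hl2 (s6 (this ▸ hl3))
  have c1 := fun l2 l3 h2 h3 e2 e3 => crossing_mid hX1 hY23 (fun p hp => n12 p (s1 hp)) n23 d1 hl1 hr1
    (l1 := l2) (l2 := l3) h2 h3 (s3 hr2) el1 er1 e2 e3 er2
  have c2 := fun l2 l3 h2 h3 e2 e3 => crossing_mid hX2 hY13 (fun p hp => n12 p (s2 hp)) n13 d2 hl2 hr2
    (l1 := l2) (l2 := l3) h2 h3 (s5 hr1) el2 er2 e2 e3 er1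
  have c3 := fun l2 l3 h2 h3 e2 e3 => crossing_mid hX3 hY12 (fun p hp => n23 p (s4 hp)) n12 d3 hl3 hr3
    (l1 := l2) (l2 := l3) h2 h3 (s1 hr1) el3 er3 e2 e3 er1
  rcases lt_or_gt_of_ne n12' with h | h <;> rcases lt_or_gt_of_ne n13' with h' | h' <;>
    rcases lt_or_gt_of_ne n23' with h'' | h''
  · exact c2 l1 l3 (s5 hl1) (s6 hl3) el1 el3 h h''
  · exact c3 l1 l2 (s1 hl1) (s2 hl2) el1 el2 h' h''
  · linarith
  · exact c1 l3 l2 (s4 hl3) (s3 hl2) el3 el2 h' h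
  · exact c1 l2 l3 (s3 hl2) (s4 hl3) el2 el3 h h'
  · linarith
  · exact c3 l2 l1 (s2 hl2) (s1 hl1) el2 el1 h'' h'
  · exact c2 l3 l1 (s6 hl3) (s5 hl1) el3 el1 h'' h

/-- The right half-strip. -/
def hStrip (x0 : ℝ) : Set ℂ := {s | x0 < s.re ∧ |s.im| < Real.pi / 2}

/-- vertical segment -/
def vSeg (κ p q : ℝ) : Set ℂ := {s | s.re = κ ∧ p ≤ s.im ∧ s.im ≤ q}

/-- horizontal segment -/
def hSeg (y p q : ℝ) : Set ℂ := {s | s.im = y ∧ p ≤ s.re ∧ s.re ≤ q}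

theorem vSeg_pc {κ p q : ℝ} (h : p ≤ q) : IsPathConnected (vSeg κ p q) := by
  have : vSeg κ p q = {κ} ×ℂ Icc p q := by
    ext s; simp [vSeg, Complex.mem_reProdIm]
  rw [this]
  exact (((convex_singleton κ).linear_preimage Complex.reLm).inter
    ((convex_Icc p q).linear_preimage Complex.imLm)).isPathConnected
    ⟨⟨κ, p⟩, by simp [Complex.mem_reProdIm, h]⟩

theorem hSeg_pc {y p q : ℝ} (h : p ≤ q) : IsPathConnected (hSeg y p q) := by
  have : hSeg y p q = Icc p q ×ℂ {y} := by
    ext s; simp [hSeg, Complex.mem_reProdIm, and_comm]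
  rw [this]
  exact (((convex_Icc p q).linear_preimage Complex.reLm).inter
    ((convex_singleton y).linear_preimage Complex.imLm)).isPathConnected
    ⟨⟨p, y⟩, by simp [Complex.mem_reProdIm, h]⟩

/-- A finger. -/
structure Finger (L : ℂ → ℂ) (N x0 σ a b κ : ℝ) (G : Set ℂ) : Prop where
  ha : x0 ≤ a
  hκ1 : a < κ
  hκ2 : κ < b
  pc : IsPathConnected G
  win : ∀ s ∈ G, a < s.re ∧ s.re < b ∧ 0 ≤ s.im ∧ s.im < Real.pi / 2
  bd : ∀ s ∈ G, |(L s).re| ≤ N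
  tip : ∃ e ∈ G, (L e).re = σ
  mem : (κ : ℂ) ∈ G
  vert : ∀ s ∈ hStrip x0, s.re = κ → |(L s).re| ≤ N

theorem exists_finger {L : ℂ → ℂ} {N x0 T : ℝ} {c : ℕ → ℝ} {γ : ℝ → ℂ}
    (hL : ContinuousOn L (hStrip x0)) (hc : Tendsto c atTop atTop)
    (hv : ∀ n, ∀ s ∈ hStrip x0, s.re = c n → |(L s).re| ≤ N)
    (hγ : ContinuousOn γ (Ici T)) (hγS : ∀ t ≥ T, γ t ∈ hStrip x0)
    (hγi : ∀ t ≥ T, 0 ≤ (γ t).im) (hγre : Tendsto (fun t => (γ t).re) atTop atTop)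
    (hlow : ∀ t ≥ T, -N ≤ (L (γ t)).re) (hfreq : ∃ᶠ t in atTop, N ≤ (L (γ t)).re)
    (a : ℝ) (ha : x0 ≤ a) : ∃ b κ G, Finger L N x0 N a b κ G := by
  obtain ⟨t1, ht1⟩ := eventually_atTop.1 ((hγre.eventually_gt_atTop a).and (eventually_ge_atTop T))
  obtain ⟨tk, htk, htkN⟩ := frequently_atTop.1 hfreq t1
  obtain ⟨n, hn⟩ := (hc.eventually_gt_atTop (γ tk).re).exists
  have hTk : T ≤ tk := (ht1 tk htk).2
  have hre : ContinuousOn (fun t => (γ t).re) (Ici T) := Complex.continuous_re.comp_continuousOn hγ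
  obtain ⟨t2, ht2, ht2'⟩ := ((hγre.eventually_ge_atTop (c n)).and (eventually_ge_atTop tk)).exists
  obtain ⟨s, ⟨hs1, hs2⟩, hs3⟩ := intermediate_value_Icc ht2'
    (hre.mono fun x hx => hTk.trans hx.1) ⟨hn.le, ht2⟩
  simp only at hs3
  have hf : ContinuousOn (fun t => (L (γ t)).re) (Ici T) :=
    Complex.continuous_re.comp_continuousOn (hL.comp hγ fun t ht => hγS t ht)
  have hsT : T ≤ s := hTk.trans hs1
  have hfs := (abs_le.1 (hv n (γ s) (hγS s hsT) hs3)).2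
  have hcomp : IsCompact {t ∈ Icc tk s | N ≤ (L (γ t)).re} := by
    have : {t ∈ Icc tk s | N ≤ (L (γ t)).re} = Icc tk s ∩ (fun t => (L (γ t)).re) ⁻¹' Ici N := rfl
    rw [this]
    exact isCompact_Icc.of_isClosed_subset ((hf.mono fun x hx => hTk.trans hx.1).preimage_isClosed_of_isClosed
      isClosed_Icc isClosed_Ici) inter_subset_left
  obtain ⟨t', ⟨⟨ht'1, ht'2⟩, ht'N⟩, hmax⟩ := hcomp.exists_isGreatest ⟨tk, ⟨le_rfl, hs1⟩, htkN⟩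
  have hafter : ∀ t, t' < t → t ≤ s → (L (γ t)).re < N := fun t h1 h2 => by
    by_contra! h
    exact absurd (hmax ⟨⟨ht'1.trans h1.le, h2⟩, h⟩) (not_le.2 h1)
  have heq : (L (γ t')).re = N := by
    by_contra hne
    have hgt : N < (L (γ t')).re := lt_of_le_of_ne ht'N (Ne.symm hne)
    obtain ⟨t, ⟨h1, h2⟩, h3⟩ := intermediate_value_Icc' ht'2
      (hf.mono fun x hx => (hTk.trans ht'1).trans hx.1) ⟨hfs, ht'N⟩
    rcases h1.eq_or_lt with rfl | h
    · exact hne h3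
    · exact absurd h3 (hafter t h h2).ne
  have hcont : ContinuousOn γ (Icc t' s) := hγ.mono fun x hx => (hTk.trans ht'1).trans hx.1
  obtain ⟨b0, hb0⟩ := (isCompact_Icc (a := t') (b := s)).bddAbove_image
    (hre.mono fun x hx => (hTk.trans ht'1).trans hx.1)
  have hb0' : ∀ t ∈ Icc t' s, (γ t).re ≤ b0 := fun t ht => hb0 ⟨t, ht, rfl⟩
  have hsb := hb0' s ⟨ht'2, le_rfl⟩
  have him := hγi s hsT
  have hSs := (abs_lt.1 (hγS s hsT).2).2
  have hss := (ht1 s (htk.trans hs1)).1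
  have hvv : ∀ p ∈ vSeg (c n) 0 (γ s).im, p ∈ hStrip x0 := fun p hp => by
    refine ⟨by rw [hp.1, ← hs3]; linarith, abs_lt.2 ⟨?_, ?_⟩⟩ <;> linarith [hp.2.1, hp.2.2]
  refine ⟨b0 + 1, c n, γ '' Icc t' s ∪ vSeg (c n) 0 (γ s).im, ⟨ha, by rw [← hs3]; exact hss, by linarith,
    ?_, ?_, ?_, ?_, ?_, hv n⟩⟩
  · refine IsPathConnected.union ?_ (vSeg_pc him) ⟨γ s, ⟨s, ⟨ht'2, le_rfl⟩, rfl⟩, hs3, him, le_rfl⟩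
    exact ((convex_Icc t' s).isPathConnected ⟨s, ht'2, le_rfl⟩).image' hcont
  · rintro p (⟨t, ht, rfl⟩ | hp)
    · have h1 := ht1 t (htk.trans (ht'1.trans ht.1))
      exact ⟨h1.1, by linarith [hb0' t ht], hγi t h1.2, (abs_lt.1 (hγS t h1.2).2).2⟩
    · exact ⟨by rw [hp.1, ← hs3]; exact hss, by rw [hp.1]; linarith, hp.2.1, by linarith [hp.2.2]⟩
  · rintro p (⟨t, ht, rfl⟩ | hp)
    · refine abs_le.2 ⟨hlow t ((hTk.trans ht'1).trans ht.1), ?_⟩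
      rcases ht.1.eq_or_lt with rfl | h
      · exact heq.le
      · exact (hafter t h ht.2).le
    · exact hv n p (hvv p hp) hp.1
  · exact ⟨γ t', Or.inl ⟨t', ⟨le_rfl, ht'2⟩, rfl⟩, heq⟩
  · exact Or.inr ⟨by simp, by simp, by simpa using him⟩

theorem Finger.neg {L : ℂ → ℂ} {N x0 σ a b κ : ℝ} {G : Set ℂ}
    (h : Finger (fun s => -L s) N x0 σ a b κ G) : Finger L N x0 (-σ) a b κ G where
  ha := h.ha
  hκ1 := h.hκ1
  hκ2 := h.hκ2
  pc := h.pc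
  win := h.win
  bd := fun s hs => by simpa using h.bd s hs
  tip := by
    obtain ⟨e, he, h'⟩ := h.tip
    refine ⟨e, he, ?_⟩
    rw [← h']; simp
  mem := h.mem
  vert := fun s hs h' => by simpa using h.vert s hs h'

/-- Two fingers joined along a horizontal segment. -/
def brSet (y κ κ' : ℝ) (G G' : Set ℂ) : Set ℂ :=
  (((G ∪ vSeg κ y 0) ∪ hSeg y κ κ') ∪ vSeg κ' y 0) ∪ G'

theorem bridge {L : ℂ → ℂ} {N x0 σ a b κ σ' a' b' κ' y : ℝ} {G G' : Set ℂ}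
    (h : Finger L N x0 σ a b κ G) (h' : Finger L N x0 σ' a' b' κ' G') (hb : b ≤ a')
    (hy : y < 0) (hy' : -(Real.pi / 2) < y) (hR : ∀ s ∈ hStrip x0, s.im = y → |(L s).re| ≤ N) :
    IsPathConnected (brSet y κ κ' G G') ∧
    (∀ s ∈ brSet y κ κ' G G', s ∈ hStrip x0 ∧ |(L s).re| ≤ N ∧
      a < s.re ∧ s.re < b' ∧ y ≤ s.im ∧ (s.im = y ∨ s.re < b ∨ a' < s.re)) ∧
    (∃ e ∈ brSet y κ κ' G G', (L e).re = σ) ∧ (∃ e ∈ brSet y κ κ' G G', (L e).re = σ') := by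
  have := h.ha
  have := h.hκ1
  have := h.hκ2
  have := h'.ha
  have := h'.hκ1
  have := h'.hκ2
  refine ⟨?_, ?_, ?_, ?_⟩
  · refine (((h.pc.union (vSeg_pc hy.le) ?_).union (hSeg_pc (by linarith)) ?_).union
      (vSeg_pc hy.le) ?_).union h'.pc ?_
    · exact ⟨κ, h.mem, by simp, by simpa using hy.le, by simp⟩
    · exact ⟨⟨κ, y⟩, Or.inr ⟨rfl, le_rfl, hy.le⟩, rfl, le_rfl, by simp; linarith⟩
    · exact ⟨⟨κ', y⟩, Or.inr ⟨rfl, by simp; linarith, le_rfl⟩, rfl, le_rfl, hy.le⟩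
    · exact ⟨κ', Or.inr ⟨by simp, by simpa using hy.le, by simp⟩, h'.mem⟩
  · have st : ∀ s : ℂ, x0 < s.re → y ≤ s.im → s.im < Real.pi / 2 → s ∈ hStrip x0 := fun s h1 h2 h3 =>
      ⟨h1, abs_lt.2 ⟨by linarith, h3⟩⟩
    rintro s ((((hs | hs) | hs) | hs) | hs)
    · have w := h.win s hs
      exact ⟨st s (by linarith) (by linarith) w.2.2.2, h.bd s hs, w.1, by linarith, by linarith,
        Or.inr (Or.inl w.2.1)⟩
    · obtain ⟨e1, e2, e3⟩ := hs
      have : s ∈ hStrip x0 := st s (by linarith) e2 (by linarith [Real.pi_pos])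
      exact ⟨this, h.vert s this e1, by linarith, by linarith, e2, Or.inr (Or.inl (by linarith))⟩
    · obtain ⟨e1, e2, e3⟩ := hs
      have : s ∈ hStrip x0 := st s (by linarith) e1.ge (by linarith [Real.pi_pos])
      exact ⟨this, hR s this e1, by linarith, by linarith, e1.ge, Or.inl e1⟩
    · obtain ⟨e1, e2, e3⟩ := hs
      have : s ∈ hStrip x0 := st s (by linarith) e2 (by linarith [Real.pi_pos])
      exact ⟨this, h'.vert s this e1, by linarith, by linarith, e2, Or.inr (Or.inr (by linarith))⟩
    · have w := h'.win s hs
      exact ⟨st s (by linarith) (by linarith) w.2.2.2, h'.bd s hs, by linarith, by linarith, by linarith,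
        Or.inr (Or.inr w.1)⟩
  · obtain ⟨e, he, h1⟩ := h.tip
    exact ⟨e, Or.inl (Or.inl (Or.inl (Or.inl he))), h1⟩
  · obtain ⟨e, he, h1⟩ := h'.tip
    exact ⟨e, Or.inr he, h1⟩

theorem core_top {L : ℂ → ℂ} {N x0 T y1 y2 : ℝ} {c : ℕ → ℝ} {γ γ' : ℝ → ℂ}
    (hL : ContinuousOn L (hStrip x0)) (hinj : InjOn L (hStrip x0)) (hc : Tendsto c atTop atTop)
    (hv : ∀ n, ∀ s ∈ hStrip x0, s.re = c n → |(L s).re| ≤ N)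
    (hy2 : -(Real.pi / 2) < y2) (hy12 : y2 < y1) (hy1 : y1 < 0)
    (hR1 : ∀ s ∈ hStrip x0, s.im = y1 → |(L s).re| ≤ N)
    (hR2 : ∀ s ∈ hStrip x0, s.im = y2 → |(L s).re| ≤ N)
    (hγ : ContinuousOn γ (Ici T)) (hγS : ∀ t ≥ T, γ t ∈ hStrip x0)
    (hγi : ∀ t ≥ T, 0 ≤ (γ t).im) (hγre : Tendsto (fun t => (γ t).re) atTop atTop)
    (hlow : ∀ t ≥ T, -N ≤ (L (γ t)).re) (hfreq : ∃ᶠ t in atTop, N ≤ (L (γ t)).re)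
    (hγ' : ContinuousOn γ' (Ici T)) (hγS' : ∀ t ≥ T, γ' t ∈ hStrip x0)
    (hγi' : ∀ t ≥ T, 0 ≤ (γ' t).im) (hγre' : Tendsto (fun t => (γ' t).re) atTop atTop)
    (hlow' : ∀ t ≥ T, (L (γ' t)).re ≤ N) (hfreq' : ∃ᶠ t in atTop, (L (γ' t)).re ≤ -N) : False := by
  have fr : ∀ a, x0 ≤ a → ∃ b κ G, Finger L N x0 N a b κ G :=
    exists_finger hL hc hv hγ hγS hγi hγre hlow hfreq
  have fl : ∀ a, x0 ≤ a → ∃ b κ G, Finger L N x0 (-N) a b κ G := fun a ha => by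
    obtain ⟨b, κ, G, h⟩ := exists_finger (L := fun s => -L s) (N := N) hL.neg hc
      (fun n s hs h => by simpa using hv n s hs h) hγ' hγS' hγi' hγre'
      (fun t ht => by simpa using hlow' t ht)
      (hfreq'.mono fun t ht => by simpa using le_neg.1 ht) a ha
    exact ⟨b, κ, G, h.neg⟩
  obtain ⟨a2, k1, G1, f1⟩ := fr x0 le_rfl
  obtain ⟨a3, k2, G2, f2⟩ := fl a2 (by linarith [f1.ha, f1.hκ1, f1.hκ2])
  obtain ⟨a4, k3, G3, f3⟩ := fr a3 (by linarith [f2.ha, f2.hκ1, f2.hκ2])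
  obtain ⟨a5, k4, G4, f4⟩ := fl a4 (by linarith [f3.ha, f3.hκ1, f3.hκ2])
  obtain ⟨a6, k5, G5, f5⟩ := fr a5 (by linarith [f4.ha, f4.hκ1, f4.hκ2])
  obtain ⟨a7, k6, G6, f6⟩ := fl a6 (by linarith [f5.ha, f5.hκ1, f5.hκ2])
  have i1 := f1.hκ1
  have j1 := f1.hκ2
  have i2 := f2.hκ1
  have j2 := f2.hκ2
  have i3 := f3.hκ1
  have j3 := f3.hκ2
  have i4 := f4.hκ1
  have j4 := f4.hκ2
  have i5 := f5.hκ1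
  have j5 := f5.hκ2
  have i6 := f6.hκ1
  have j6 := f6.hκ2
  have hy2' : y2 < 0 := hy12.trans hy1
  have hy1' : -(Real.pi / 2) < y1 := hy2.trans hy12
  obtain ⟨pA, bA, tA, tA'⟩ := bridge f1 f6 (by linarith) hy2' hy2 hR2
  obtain ⟨pB, bB, tB, tB'⟩ := bridge f2 f3 (by linarith) hy1 hy1' hR1
  obtain ⟨pC, bC, tC, tC'⟩ := bridge f4 f5 (by linarith) hy1 hy1' hR1
  have mA : ∀ k, k1 ≤ k → k ≤ k6 → (⟨k, y2⟩ : ℂ) ∈ brSet y2 k1 k6 G1 G6 := fun k h h' =>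
    Or.inl (Or.inl (Or.inr ⟨rfl, h, h'⟩))
  have mB : ∀ k, k2 ≤ k → k ≤ k3 → (⟨k, y1⟩ : ℂ) ∈ brSet y1 k2 k3 G2 G3 := fun k h h' =>
    Or.inl (Or.inl (Or.inr ⟨rfl, h, h'⟩))
  have mC : ∀ k, k4 ≤ k → k ≤ k5 → (⟨k, y1⟩ : ℂ) ∈ brSet y1 k4 k5 G4 G5 := fun k h h' =>
    Or.inl (Or.inl (Or.inr ⟨rfl, h, h'⟩))
  set A := brSet y2 k1 k6 G1 G6
  set B := brSet y1 k2 k3 G2 G3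
  set C := brSet y1 k4 k5 G4 G5
  have pAB : IsPathConnected (A ∪ vSeg k2 y2 y1 ∪ B) :=
    (pA.union (vSeg_pc hy12.le) ⟨⟨k2, y2⟩, mA _ (by linarith) (by linarith), rfl, le_rfl, hy12.le⟩).union pB
      ⟨⟨k2, y1⟩, Or.inr ⟨rfl, hy12.le, le_rfl⟩, mB _ (by linarith) (by linarith)⟩
  have pAC : IsPathConnected (A ∪ vSeg k4 y2 y1 ∪ C) :=
    (pA.union (vSeg_pc hy12.le) ⟨⟨k4, y2⟩, mA _ (by linarith) (by linarith), rfl, le_rfl, hy12.le⟩).union pC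
      ⟨⟨k4, y1⟩, Or.inr ⟨rfl, hy12.le, le_rfl⟩, mC _ (by linarith) (by linarith)⟩
  have pBC : IsPathConnected (B ∪ hSeg y1 k3 k4 ∪ C) :=
    (pB.union (hSeg_pc (by linarith)) ⟨⟨k3, y1⟩, mB _ (by linarith) (by linarith), rfl, le_rfl,
      by simp; linarith⟩).union pC
      ⟨⟨k4, y1⟩, Or.inr ⟨rfl, by simp; linarith, le_rfl⟩, mC _ (by linarith) (by linarith)⟩
  have vst : ∀ k, x0 < k → ∀ s ∈ vSeg k y2 y1, s ∈ hStrip x0 := fun k hk s hs =>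
    ⟨by rw [hs.1]; exact hk, abs_lt.2 ⟨by linarith [hs.2.1], by linarith [hs.2.2, Real.pi_pos]⟩⟩
  have hst : ∀ s ∈ hSeg y1 k3 k4, s ∈ hStrip x0 := fun s hs =>
    ⟨by linarith [hs.2.1], abs_lt.2 ⟨by linarith [hs.1], by linarith [hs.1, Real.pi_pos]⟩⟩
  have bAB : ∀ s ∈ A ∪ vSeg k2 y2 y1 ∪ B, s ∈ hStrip x0 ∧ |(L s).re| ≤ N := by
    rintro s ((hs | hs) | hs)
    · exact ⟨(bA s hs).1, (bA s hs).2.1⟩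
    · have := vst k2 (by linarith) s hs
      exact ⟨this, f2.vert s this hs.1⟩
    · exact ⟨(bB s hs).1, (bB s hs).2.1⟩
  have bAC : ∀ s ∈ A ∪ vSeg k4 y2 y1 ∪ C, s ∈ hStrip x0 ∧ |(L s).re| ≤ N := by
    rintro s ((hs | hs) | hs)
    · exact ⟨(bA s hs).1, (bA s hs).2.1⟩
    · have := vst k4 (by linarith) s hs
      exact ⟨this, f4.vert s this hs.1⟩
    · exact ⟨(bC s hs).1, (bC s hs).2.1⟩
  have bBC : ∀ s ∈ B ∪ hSeg y1 k3 k4 ∪ C, s ∈ hStrip x0 ∧ |(L s).re| ≤ N := by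
    rintro s ((hs | hs) | hs)
    · exact ⟨(bB s hs).1, (bB s hs).2.1⟩
    · have := hst s hs
      exact ⟨this, hR1 s this hs.1⟩
    · exact ⟨(bC s hs).1, (bC s hs).2.1⟩
  have img : ∀ X : Set ℂ, IsPathConnected X → (∀ s ∈ X, s ∈ hStrip x0) → IsPathConnected (L '' X) :=
    fun X hX h => hX.image' (hL.mono h)
  have dis : ∀ X Y : Set ℂ, (∀ s ∈ X, s ∈ hStrip x0) → (∀ s ∈ Y, s ∈ hStrip x0) →
      (∀ s ∈ X, s ∉ Y) → Disjoint (L '' X) (L '' Y) := fun X Y hX hY h => by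
    rw [Set.disjoint_left]
    rintro _ ⟨x, hx, rfl⟩ ⟨y, hy, hxy⟩
    exact h x hx (hinj (hY y hy) (hX x hx) hxy ▸ hy)
  have ex : ∀ (X : Set ℂ) (σ : ℝ), (∃ e ∈ X, (L e).re = σ) → ∃ p ∈ L '' X, p.re = σ := by
    rintro X σ ⟨e, he, h⟩
    exact ⟨L e, ⟨e, he, rfl⟩, h⟩
  have nn : ∀ X : Set ℂ, (∀ s ∈ X, s ∈ hStrip x0 ∧ |(L s).re| ≤ N) → ∀ p ∈ L '' X, |p.re| ≤ N := by
    rintro X h _ ⟨e, he, rfl⟩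
    exact (h e he).2
  have sA : ∀ s ∈ A, s ∈ hStrip x0 := fun s hs => (bA s hs).1
  have sB : ∀ s ∈ B, s ∈ hStrip x0 := fun s hs => (bB s hs).1
  have sC : ∀ s ∈ C, s ∈ hStrip x0 := fun s hs => (bC s hs).1
  have l1 : ∀ X Y Z : Set ℂ, L '' X ⊆ L '' (X ∪ Y ∪ Z) := fun X Y Z =>
    image_mono fun x hx => Or.inl (Or.inl hx)
  have l2 : ∀ X Y Z : Set ℂ, L '' Z ⊆ L '' (X ∪ Y ∪ Z) := fun X Y Z =>
    image_mono fun x hx => Or.inr hx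
  refine three_crossing (N := N) (img A pA sA) (img B pB sB) (img C pC sC)
    (img _ pAB fun s hs => (bAB s hs).1) (img _ pBC fun s hs => (bBC s hs).1)
    (img _ pAC fun s hs => (bAC s hs).1) (l1 _ _ _) (l2 _ _ _) (l1 _ _ _) (l2 _ _ _) (l1 _ _ _)
    (l2 _ _ _) (nn _ bAB) (nn _ bBC) (nn _ bAC)
    (dis _ _ sA (fun s hs => (bBC s hs).1) ?_) (dis _ _ sB (fun s hs => (bAC s hs).1) ?_)
    (dis _ _ sC (fun s hs => (bAB s hs).1) ?_)
    (ex _ _ tA') (ex _ _ tB) (ex _ _ tC) (ex _ _ tA) (ex _ _ tB') (ex _ _ tC')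
  · intro s hs
    obtain ⟨-, -, u1, u2, u3, u4⟩ := bA s hs
    rintro ((h | h) | h)
    · obtain ⟨-, -, v1, v2, v3, v4⟩ := bB s h
      rcases u4 with u | u | u <;> linarith
    · obtain ⟨v1, v2, v3⟩ := h
      rcases u4 with u | u | u <;> linarith
    · obtain ⟨-, -, v1, v2, v3, v4⟩ := bC s h
      rcases u4 with u | u | u <;> linarith
  · intro s hs
    obtain ⟨-, -, u1, u2, u3, -⟩ := bB s hs
    rintro ((h | h) | h)
    · obtain ⟨-, -, v1, v2, v3, v4⟩ := bA s h
      rcases v4 with u | u | u <;> linarith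
    · obtain ⟨v1, v2, v3⟩ := h
      linarith
    · obtain ⟨-, -, v1, v2, v3, v4⟩ := bC s h
      linarith
  · intro s hs
    obtain ⟨-, -, u1, u2, u3, -⟩ := bC s hs
    rintro ((h | h) | h)
    · obtain ⟨-, -, v1, v2, v3, v4⟩ := bA s h
      rcases v4 with u | u | u <;> linarith
    · obtain ⟨v1, v2, v3⟩ := h
      linarith
    · obtain ⟨-, -, v1, v2, v3, v4⟩ := bB s h
      linarith

open MeasureTheory in
theorem osc_bound {f f' : ℝ → ℂ} {a b δ : ℝ} (hab : a ≤ b) (hδ : 0 < δ)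
    (hf : ∀ x ∈ Icc a b, HasDerivAt f (f' x) x) (hf' : ContinuousOn f' (Icc a b))
    {s : Set ℝ} (hs : Ioc a b ⊆ s)
    (hI : ∫⁻ x in s, ENNReal.ofReal (‖f' x‖ ^ 2) ≤ ENNReal.ofReal (δ ^ 2)) :
    ‖f b - f a‖ ≤ δ * (b - a) + δ := by
  have hu : uIcc a b = Icc a b := uIcc_of_le hab
  have hi : IntervalIntegrable f' volume a b := (hu.symm ▸ hf' : ContinuousOn f' (uIcc a b)).intervalIntegrable
  have hi2 : IntervalIntegrable (fun x => ‖f' x‖ ^ 2) volume a b :=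
    (hu.symm ▸ (hf'.norm.pow 2) : ContinuousOn (fun x => ‖f' x‖ ^ 2) (uIcc a b)).intervalIntegrable
  have e := intervalIntegral.integral_eq_sub_of_hasDerivAt (f := f) (f' := f') (a := a) (b := b)
    (fun x hx => hf x (hu ▸ hx)) hi
  have e2 : ∫ x in a..b, ‖f' x‖ ^ 2 ≤ δ ^ 2 := by
    rw [intervalIntegral.integral_of_le hab]
    rw [← ENNReal.ofReal_le_ofReal_iff (by positivity),
      ofReal_integral_eq_lintegral_ofReal hi2.1 (Eventually.of_forall fun x => by positivity)]
    exact (lintegral_mono_set hs).trans hI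
  rw [← e]
  calc ‖∫ x in a..b, f' x‖ ≤ ∫ x in a..b, ‖f' x‖ := intervalIntegral.norm_integral_le_integral_norm hab
    _ ≤ ∫ x in a..b, (δ + δ⁻¹ * ‖f' x‖ ^ 2) := by
        refine intervalIntegral.integral_mono_on hab hi.norm
          ((intervalIntegrable_const).add (hi2.const_mul _)) fun x _ => ?_
        have : ‖f' x‖ * δ ≤ (δ + δ⁻¹ * ‖f' x‖ ^ 2) * δ := by
          have : (δ + δ⁻¹ * ‖f' x‖ ^ 2) * δ = δ ^ 2 + ‖f' x‖ ^ 2 := by field_simp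
          rw [this]
          nlinarith [sq_nonneg (‖f' x‖ - δ), sq_nonneg (‖f' x‖ + δ), norm_nonneg (f' x)]
        exact le_of_mul_le_mul_right this hδ
    _ = δ * (b - a) + δ⁻¹ * ∫ x in a..b, ‖f' x‖ ^ 2 := by
        rw [intervalIntegral.integral_add intervalIntegrable_const (hi2.const_mul _)]
        simp [mul_comm]
    _ ≤ δ * (b - a) + δ⁻¹ * δ ^ 2 := by gcongr
    _ = _ := by field_simp

open MeasureTheory in
theorem tail_tendsto {g : ℝ → ENNReal} {x0 : ℝ} (hg : ∫⁻ x in Ioi x0, g x ≠ ⊤) :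
    Tendsto (fun n : ℕ => ∫⁻ x in Ioc (x0 + n) (x0 + n + 1), g x) atTop (𝓝 0) := by
  apply ENNReal.tendsto_atTop_zero_of_tsum_ne_top
  rw [← lintegral_iUnion (fun i => measurableSet_Ioc)]
  · refine ne_top_of_le_ne_top hg (lintegral_mono_set ?_)
    refine iUnion_subset fun n x hx => ?_
    have : (0 : ℝ) ≤ n := by positivity
    exact lt_of_le_of_lt (by linarith) hx.1
  · intro i j hij
    have := pairwise_disjoint_Ioc_add_intCast x0 (i := (i : ℤ)) (j := (j : ℤ)) (by exact_mod_cast hij)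
    simpa [Function.onFun] using this

theorem isOpen_hStrip (x0 : ℝ) : IsOpen (hStrip x0) :=
  (isOpen_lt continuous_const Complex.continuous_re).inter
    (isOpen_lt (continuous_abs.comp Complex.continuous_im) continuous_const)

theorem det_mul_clm (a : ℂ) :
    ((ContinuousLinearMap.toSpanSingleton ℂ a).restrictScalars ℝ).det = ‖a‖ ^ 2 := by
  have h : (((ContinuousLinearMap.toSpanSingleton ℂ a).restrictScalars ℝ : ℂ →L[ℝ] ℂ) : ℂ →ₗ[ℝ] ℂ)
      = LinearMap.mulLeft ℝ a := by
    ext <;> simp [mul_comm]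
  rw [ContinuousLinearMap.det, h]
  have := Algebra.norm_complex_apply a
  rw [Complex.normSq_eq_norm_sq] at this
  rw [← this, Algebra.norm_apply]
  rfl

open MeasureTheory in
theorem area_fin {h : ℂ → ℂ} {x0 B : ℝ} (hd : DifferentiableOn ℂ h (hStrip x0))
    (hinj : InjOn h (hStrip x0)) (hB : ∀ s ∈ hStrip x0, ‖h s‖ ≤ B) :
    ∫⁻ s in hStrip x0, ENNReal.ofReal (‖deriv h s‖ ^ 2) ≠ ⊤ := by
  have key := lintegral_abs_det_fderiv_eq_addHaar_image (μ := volume) (f := h)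
    (f' := fun s => (ContinuousLinearMap.toSpanSingleton ℂ (deriv h s)).restrictScalars ℝ)
    (isOpen_hStrip x0).measurableSet (fun s hs => by
      have : HasDerivAt h (deriv h s) s :=
        (hd.differentiableAt ((isOpen_hStrip x0).mem_nhds hs)).hasDerivAt
      exact (this.hasFDerivAt.restrictScalars ℝ).hasFDerivWithinAt) hinj
  have key2 : ∫⁻ s in hStrip x0, ENNReal.ofReal (‖deriv h s‖ ^ 2) = volume (h '' hStrip x0) := by
    rw [← key]
    refine lintegral_congr fun s => ?_
    rw [det_mul_clm, abs_of_nonneg (by positivity)]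
  rw [key2]
  refine ne_top_of_le_ne_top (measure_closedBall_lt_top (x := (0 : ℂ)) (r := B)).ne (measure_mono ?_)
  rintro _ ⟨s, hs, rfl⟩
  simpa using hB s hs

open MeasureTheory in
theorem area_prod {J : ℂ → ENNReal} (hJ : Measurable J) {x0 : ℝ}
    (h : ∫⁻ s in hStrip x0, J s ≠ ⊤) :
    ∫⁻ p, J ⟨p.1, p.2⟩ ∂((volume.restrict (Ioi x0)).prod
      (volume.restrict (Ioo (-(Real.pi / 2)) (Real.pi / 2)))) ≠ ⊤ := by
  have e := Complex.volume_preserving_equiv_real_prod.symm.setLIntegral_comp_preimage_emb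
    Complex.measurableEquivRealProd.symm.measurableEmbedding J (hStrip x0)
  rw [Measure.prod_restrict, ← Measure.volume_eq_prod]
  have hs : (Complex.measurableEquivRealProd.symm ⁻¹' hStrip x0) =
      Ioi x0 ×ˢ Ioo (-(Real.pi / 2)) (Real.pi / 2) := by
    ext p
    simp [hStrip, Complex.measurableEquivRealProd_symm_apply, abs_lt]
  rw [hs] at e
  rw [← e] at h
  exact h

open MeasureTheory in
theorem wolff {h : ℂ → ℂ} {x0 B : ℝ} (hd : DifferentiableOn ℂ h (hStrip x0))
    (hinj : InjOn h (hStrip x0)) (hB : ∀ s ∈ hStrip x0, ‖h s‖ ≤ B) :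
    ∃ c : ℕ → ℝ, (∀ n : ℕ, c n ∈ Ioc (x0 + n) (x0 + n + 1)) ∧
      (∀ ε > 0, ∀ᶠ n in atTop, ∀ s ∈ hStrip x0, ∀ s' ∈ hStrip x0, s.re = c n → s'.re = c n →
        ‖h s - h s'‖ ≤ ε) ∧
      ∀ᵐ y ∂(volume.restrict (Ioo (-(Real.pi / 2)) (Real.pi / 2))),
        ∀ ε > 0, ∀ᶠ n : ℕ in atTop, ∀ s ∈ hStrip x0, ∀ s' ∈ hStrip x0, s.im = y → s'.im = y →
          s.re ∈ Ioc (x0 + n) (x0 + n + 1) → s'.re ∈ Ioc (x0 + n) (x0 + n + 1) →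
          ‖h s - h s'‖ ≤ ε := by
  have hJm : Measurable fun s => ENNReal.ofReal (‖deriv h s‖ ^ 2) := by
    have := measurable_deriv h
    fun_prop
  have hmk : Measurable fun p : ℝ × ℝ => (⟨p.1, p.2⟩ : ℂ) :=
    Complex.measurableEquivRealProd.symm.measurable
  have hJm2 : Measurable fun p : ℝ × ℝ => ENNReal.ofReal (‖deriv h ⟨p.1, p.2⟩‖ ^ 2) := hJm.comp hmk
  have hA := area_prod hJm (area_fin hd hinj hB)
  have hdd : ∀ s ∈ hStrip x0, HasDerivAt h (deriv h s) s := fun s hs =>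
    (hd.differentiableAt ((isOpen_hStrip x0).mem_nhds hs)).hasDerivAt
  have hcd : ContinuousOn (deriv h) (hStrip x0) := (hd.deriv (isOpen_hStrip x0)).continuousOn
  have hvert : ∀ x, x0 < x → ∀ δ > 0,
      ∫⁻ y in Ioo (-(Real.pi / 2)) (Real.pi / 2), ENNReal.ofReal (‖deriv h ⟨x, y⟩‖ ^ 2) ≤
        ENNReal.ofReal (δ ^ 2) → ∀ y y', -(Real.pi / 2) < y → y ≤ y' → y' < Real.pi / 2 →
        ‖h ⟨x, y'⟩ - h ⟨x, y⟩‖ ≤ δ * Real.pi + δ := by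
    intro x hx δ hδ hI y y' h1 h2 h3
    have hmem : ∀ t ∈ Icc y y', (⟨x, t⟩ : ℂ) ∈ hStrip x0 := fun t ht =>
      ⟨hx, abs_lt.2 ⟨by simp; linarith [ht.1], by simp; linarith [ht.2]⟩⟩
    have hline : ∀ t : ℝ, HasDerivAt (fun t : ℝ => (⟨x, t⟩ : ℂ)) Complex.I t := fun t => by
      have : (fun t : ℝ => (⟨x, t⟩ : ℂ)) = fun t : ℝ => (x : ℂ) + t * Complex.I := by
        funext t; apply Complex.ext <;> simp
      rw [this]
      simpa using ((Complex.ofRealCLM.hasDerivAt (x := t)).mul_const Complex.I).const_add (x : ℂ)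
    have hc : Continuous (fun t : ℝ => (⟨x, t⟩ : ℂ)) :=
      continuous_iff_continuousAt.2 fun t => (hline t).continuousAt
    have := osc_bound (f := fun t => h ⟨x, t⟩) (f' := fun t => deriv h ⟨x, t⟩ * Complex.I) h2 hδ
      (fun t ht => HasDerivAt.comp (h₂ := h) t (hdd _ (hmem t ht)) (hline t))
      ((hcd.comp hc.continuousOn hmem).mul continuousOn_const)
      (s := Ioo (-(Real.pi / 2)) (Real.pi / 2)) (fun t ht => ⟨by linarith [ht.1], by linarith [ht.2]⟩)
      (by simpa using hI)
    refine this.trans ?_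
    have : y' - y ≤ Real.pi := by linarith
    gcongr
  have hhor : ∀ (n : ℕ) y, |y| < Real.pi / 2 → ∀ δ > 0,
      ∫⁻ x in Ioc (x0 + n) (x0 + n + 1), ENNReal.ofReal (‖deriv h ⟨x, y⟩‖ ^ 2) ≤
        ENNReal.ofReal (δ ^ 2) → ∀ x x', x0 + n < x → x ≤ x' → x' ≤ x0 + n + 1 →
        ‖h ⟨x', y⟩ - h ⟨x, y⟩‖ ≤ δ * 1 + δ := by
    intro n y hy δ hδ hI x x' h1 h2 h3
    have hn : (0 : ℝ) ≤ n := by positivity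
    have hmem : ∀ t ∈ Icc x x', (⟨t, y⟩ : ℂ) ∈ hStrip x0 := fun t ht =>
      ⟨by simp; linarith [ht.1], hy⟩
    have hline : ∀ t : ℝ, HasDerivAt (fun t : ℝ => (⟨t, y⟩ : ℂ)) 1 t := fun t => by
      have : (fun t : ℝ => (⟨t, y⟩ : ℂ)) = fun t : ℝ => (t : ℂ) + y * Complex.I := by
        funext t; apply Complex.ext <;> simp
      rw [this]
      simpa using (Complex.ofRealCLM.hasDerivAt (x := t)).add_const (y * Complex.I)
    have hc : Continuous (fun t : ℝ => (⟨t, y⟩ : ℂ)) :=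
      continuous_iff_continuousAt.2 fun t => (hline t).continuousAt
    have := osc_bound (f := fun t => h ⟨t, y⟩) (f' := fun t => deriv h ⟨t, y⟩ * 1) h2 hδ
      (fun t ht => HasDerivAt.comp (h₂ := h) t (hdd _ (hmem t ht)) (hline t))
      ((hcd.comp hc.continuousOn hmem).mul continuousOn_const)
      (s := Ioc (x0 + n) (x0 + n + 1)) (fun t ht => ⟨by linarith [ht.1], by linarith [ht.2]⟩)
      (by simpa using hI)
    refine this.trans ?_
    have : x' - x ≤ 1 := by linarith
    gcongr
  set ν := volume.restrict (Ioo (-(Real.pi / 2)) (Real.pi / 2)) with hν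
  have hA1 : ∫⁻ x in Ioi x0, ∫⁻ y, ENNReal.ofReal (‖deriv h ⟨x, y⟩‖ ^ 2) ∂ν ≠ ⊤ := by
    rwa [lintegral_prod _ hJm2.aemeasurable] at hA
  have hA2 : ∫⁻ y, (∫⁻ x in Ioi x0, ENNReal.ofReal (‖deriv h ⟨x, y⟩‖ ^ 2)) ∂ν ≠ ⊤ := by
    rwa [lintegral_prod_symm _ hJm2.aemeasurable] at hA
  have hae : ∀ᵐ y ∂ν, ∫⁻ x in Ioi x0, ENNReal.ofReal (‖deriv h ⟨x, y⟩‖ ^ 2) < ⊤ :=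
    ae_lt_top' (hJm2.aemeasurable.lintegral_prod_left') hA2
  have hgm : Measurable fun x => ∫⁻ y, ENNReal.ofReal (‖deriv h ⟨x, y⟩‖ ^ 2) ∂ν :=
    hJm2.lintegral_prod_right'
  have hc : ∀ n : ℕ, ∃ c ∈ Ioc (x0 + n) (x0 + n + 1),
      ∫⁻ y, ENNReal.ofReal (‖deriv h ⟨c, y⟩‖ ^ 2) ∂ν ≤
      ∫⁻ x in Ioc (x0 + n) (x0 + n + 1), ∫⁻ y, ENNReal.ofReal (‖deriv h ⟨x, y⟩‖ ^ 2) ∂ν := by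
    intro n
    obtain ⟨c, hc, hc'⟩ := exists_le_setLAverage (μ := volume) (s := Ioc (x0 + n) (x0 + n + 1))
      (by simp) (by simp) hgm.aemeasurable
    refine ⟨c, hc, hc'.trans ?_⟩
    rw [setLAverage_eq]
    simp
  choose c hc hcI using hc
  refine ⟨c, hc, ?_, ?_⟩
  · intro ε hε
    set δ := ε / (Real.pi + 1) with hδd
    have hδ : 0 < δ := by positivity
    have hδε : δ * Real.pi + δ = ε := by rw [hδd]; field_simp
    filter_upwards [(tail_tendsto hA1).eventually_le_const
      (u := ENNReal.ofReal (δ ^ 2)) (by simpa using pow_pos hδ 2)] with n hn s hs s' hs' hsn hsn'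
    have hcn : x0 < c n := by
      have := (hc n).1
      have : (0 : ℝ) ≤ n := by positivity
      linarith
    have H := hvert (c n) hcn δ hδ ((hcI n).trans hn)
    have es : s = ⟨c n, s.im⟩ := Complex.ext hsn rfl
    have es' : s' = ⟨c n, s'.im⟩ := Complex.ext hsn' rfl
    have i1 := abs_lt.1 hs.2
    have i2 := abs_lt.1 hs'.2
    rw [hδε] at H
    rw [es, es']
    rcases le_total s.im s'.im with hle | hle
    · rw [norm_sub_rev]; exact H _ _ i1.1 hle i2.2
    · exact H _ _ i2.1 hle i1.2
  · filter_upwards [hae] with y hy ε hε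
    set δ := ε / 2 with hδd
    have hδ : 0 < δ := by positivity
    have hδε : δ * 1 + δ = ε := by rw [hδd]; ring
    filter_upwards [(tail_tendsto hy.ne).eventually_le_const
      (u := ENNReal.ofReal (δ ^ 2)) (by simpa using pow_pos hδ 2)] with n hn s hs s' hs' hsn hsn' h1 h2
    have hyy : |y| < Real.pi / 2 := hsn ▸ hs.2
    have H := hhor n y hyy δ hδ hn
    have es : s = ⟨s.re, y⟩ := Complex.ext rfl hsn
    have es' : s' = ⟨s'.re, y⟩ := Complex.ext rfl hsn'
    rw [hδε] at H
    rw [es, es']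
    rcases le_total s.re s'.re with hle | hle
    · rw [norm_sub_rev]; exact H _ _ h1.1 hle h2.2
    · exact H _ _ h2.1 hle h1.2

theorem exists_log_on {S : Set ℂ} (hS : IsOpen S) (hconv : Convex ℝ S) (hne : S.Nonempty)
    {f : ℂ → ℂ} (hf : ContinuousOn f S) (h0 : ∀ s ∈ S, f s ≠ 0) :
    ∃ L : ℂ → ℂ, ContinuousOn L S ∧ ∀ s ∈ S, Complex.exp (L s) = f s := by
  classical
  have : ContractibleSpace S := hconv.contractibleSpace hne
  have : LocallyPathConnectedSpace S := hS.locallyPathConnectedSpace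
  obtain ⟨g, hg, hge⟩ := exists_clog (fun s : S => f s) (continuousOn_iff_continuous_domRestrict.1 hf)
    (fun s => h0 s s.2)
  refine ⟨fun s => if hs : s ∈ S then g ⟨s, hs⟩ else 0, ?_, ?_⟩
  · rw [continuousOn_iff_continuous_domRestrict]
    convert hg using 1
    funext s
    simp
  · intro s hs
    simp only [hs, dif_pos]
    exact hge ⟨s, hs⟩

theorem convex_hStrip (x0 : ℝ) : Convex ℝ (hStrip x0) := by
  intro a ha b hb p q hp hq hpq
  have h1 := abs_lt.1 ha.2
  have h2 := abs_lt.1 hb.2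
  have ha1 : x0 < a.re := ha.1
  have hb1 : x0 < b.re := hb.1
  have key : ∀ {u v k : ℝ}, k < u → k < v → k < p * u + q * v := by
    intro u v k hu hv
    rcases hp.eq_or_lt with rfl | hp'
    · have : q = 1 := by linarith
      subst this; simpa using hv
    · have e : p * k + q * k = k := by rw [← add_mul, hpq, one_mul]
      linarith [mul_lt_mul_of_pos_left hu hp', mul_le_mul_of_nonneg_left hv.le hq]
  refine ⟨?_, abs_lt.2 ⟨?_, ?_⟩⟩
  · simpa using key ha1 hb1
  · simpa using key h1.1 h2.1
  · have := key (u := -a.im) (v := -b.im) (k := -(Real.pi / 2)) (by linarith [h1.2]) (by linarith [h2.2])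
    simp
    linarith

open MeasureTheory in
theorem ae_pick {P : ℝ → Prop} {a b p q : ℝ} (h : ∀ᵐ y ∂(volume.restrict (Ioo a b)), P y)
    (hap : a ≤ p) (hpq : p < q) (hqb : q ≤ b) : ∃ y ∈ Ioo p q, P y := by
  have h' : ∀ᵐ y ∂(volume.restrict (Ioo p q)), P y :=
    ae_mono (Measure.restrict_mono (Ioo_subset_Ioo hap hqb) le_rfl) h
  rw [ae_restrict_iff' measurableSet_Ioo] at h'
  by_contra hcon
  push Not at hcon
  have : volume (Ioo p q) = 0 := measure_mono_null (fun y hy => fun hh => hcon y hy (hh hy)) h'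
  simp at this
  linarith

theorem ivt_hit {γ : ℝ → ℂ} {T c : ℝ} (hγ : ContinuousOn γ (Ici T))
    (hre : Tendsto (fun t => (γ t).re) atTop atTop) (hc : (γ T).re ≤ c) :
    ∃ t ≥ T, (γ t).re = c := by
  obtain ⟨t1, h1, h2⟩ := ((hre.eventually_ge_atTop c).and (eventually_ge_atTop T)).exists
  have hcont : ContinuousOn (fun t => (γ t).re) (Icc T t1) :=
    Complex.continuous_re.comp_continuousOn (hγ.mono Icc_subset_Ici_self)
  obtain ⟨t, ht, he⟩ := intermediate_value_Icc h2 hcont ⟨hc, h1⟩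
  exact ⟨t, ht.1, he⟩

theorem glue {h : ℂ → ℂ} {x0 B ε T : ℝ} {z w : ℂ} (hd : DifferentiableOn ℂ h (hStrip x0))
    (hinj : InjOn h (hStrip x0)) (hB : ∀ s ∈ hStrip x0, ‖h s‖ ≤ B)
    (hz : ∀ s ∈ hStrip x0, h s ≠ z) (hw : ∀ s ∈ hStrip x0, h s ≠ w) (hzw : z ≠ w) (hε : 0 < ε)
    {γ γ' : ℝ → ℂ}
    (hγ : ContinuousOn γ (Ici T)) (hγS : ∀ t ≥ T, γ t ∈ hStrip x0) (hγi : ∀ t ≥ T, 0 ≤ (γ t).im)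
    (hγre : Tendsto (fun t => (γ t).re) atTop atTop) (hfar : ∀ t ≥ T, ε ≤ ‖h (γ t) - z‖)
    (hnear : ∀ η > 0, ∃ᶠ t in atTop, ‖h (γ t) - w‖ ≤ η)
    (hγ' : ContinuousOn γ' (Ici T)) (hγS' : ∀ t ≥ T, γ' t ∈ hStrip x0)
    (hγi' : ∀ t ≥ T, 0 ≤ (γ' t).im)
    (hγre' : Tendsto (fun t => (γ' t).re) atTop atTop) (hfar' : ∀ t ≥ T, ε ≤ ‖h (γ' t) - w‖)
    (hnear' : ∀ η > 0, ∃ᶠ t in atTop, ‖h (γ' t) - z‖ ≤ η) : False := by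
  obtain ⟨c, hc, hcv, hae⟩ := wolff hd hinj hB
  have hpi := Real.pi_gt_three
  obtain ⟨y2, hy2, hY2⟩ := ae_pick hae (p := -1) (q := -(1/2)) (by linarith) (by norm_num) (by linarith)
  obtain ⟨y1, hy1, hY1⟩ := ae_pick hae (p := -(1/2)) (q := 0) (by linarith) (by norm_num) (by linarith)
  have hctop : Tendsto c atTop atTop := by
    refine tendsto_atTop_mono (fun n => (hc n).1.le) ?_
    exact tendsto_atTop_add_const_left _ _ tendsto_natCast_atTop_atTop
  obtain ⟨N0, hN0⟩ := eventually_atTop.1 ((hcv (ε / 2) (by positivity)).and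
    ((hY1 (ε / 4) (by positivity)).and ((hY2 (ε / 4) (by positivity)).and
    ((hctop.eventually_ge_atTop (γ T).re).and (hctop.eventually_ge_atTop (γ' T).re)))))
  set x1 : ℝ := x0 + N0 with hx1
  have hx01 : x0 ≤ x1 := by
    have : (0 : ℝ) ≤ N0 := by positivity
    linarith
  have hsub : hStrip x1 ⊆ hStrip x0 := fun s hs => ⟨lt_of_le_of_lt hx01 hs.1, hs.2⟩
  have htri : ∀ {a b v : ℂ} {k l : ℝ}, k ≤ ‖a - v‖ → ‖b - a‖ ≤ l → k - l ≤ ‖b - v‖ := by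
    intro a b v k l h1 h2
    have := norm_sub_le_norm_sub_add_norm_sub a b v
    rw [norm_sub_rev a b] at this
    linarith
  have hV : ∀ n ≥ N0, ∀ s ∈ hStrip x0, s.re = c n → ε / 2 ≤ ‖h s - z‖ ∧ ε / 2 ≤ ‖h s - w‖ := by
    intro n hn s hs hsn
    obtain ⟨ho, -, -, hg1, hg2⟩ := hN0 n hn
    obtain ⟨t, ht, hte⟩ := ivt_hit hγ hγre hg1
    obtain ⟨t', ht', hte'⟩ := ivt_hit hγ' hγre' hg2
    have a1 := htri (hfar t ht) (ho s hs _ (hγS t ht) hsn hte)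
    have a2 := htri (hfar' t' ht') (ho s hs _ (hγS' t' ht') hsn hte')
    constructor <;> linarith
  have hH : ∀ y, (y = y1 ∨ y = y2) → ∀ s ∈ hStrip x1, s.im = y →
      ε / 4 ≤ ‖h s - z‖ ∧ ε / 4 ≤ ‖h s - w‖ := by
    intro y hy s hs hsy
    obtain ⟨n, hn, hsn⟩ : ∃ n : ℕ, n ≥ N0 ∧ s.re ∈ Ioc (x0 + n) (x0 + n + 1) := by
      have hs1 : x1 < s.re := hs.1
      have hpos : 0 < s.re - x0 := by linarith
      have hc1 : 0 < ⌈s.re - x0⌉₊ := Nat.ceil_pos.2 hpos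
      have h1 := Nat.ceil_lt_add_one hpos.le
      have h2 := Nat.le_ceil (s.re - x0)
      have h3 : (N0 : ℝ) < ⌈s.re - x0⌉₊ := by linarith
      have h3' : N0 < ⌈s.re - x0⌉₊ := by exact_mod_cast h3
      have h4 : ((⌈s.re - x0⌉₊ - 1 : ℕ) : ℝ) = (⌈s.re - x0⌉₊ : ℝ) - 1 := by
        rw [Nat.cast_sub hc1]; simp
      exact ⟨⌈s.re - x0⌉₊ - 1, by omega, by rw [h4]; linarith, by rw [h4]; linarith⟩
    have hp : (⟨c n, y⟩ : ℂ) ∈ hStrip x0 := by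
      refine ⟨?_, ?_⟩
      · have := (hc n).1
        have : (0 : ℝ) ≤ n := by positivity
        simp only; linarith
      · have := hs.2
        rwa [hsy] at this
    have hvv := hV n hn _ hp rfl
    have ho : ‖h s - h ⟨c n, y⟩‖ ≤ ε / 4 := by
      rcases hy with rfl | rfl
      · exact (hN0 n hn).2.1 s (hsub hs) _ hp hsy rfl hsn (hc n)
      · exact (hN0 n hn).2.2.1 s (hsub hs) _ hp hsy rfl hsn (hc n)
    have a1 := htri hvv.1 ho
    have a2 := htri hvv.2 ho
    constructor <;> linarith
  obtain ⟨L, hLc, hLe⟩ := exists_log_on (isOpen_hStrip x1) (convex_hStrip x1)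
    ⟨⟨x1 + 1, 0⟩, by simp [hStrip]; positivity⟩ (f := fun s => (h s - z) / (h s - w))
    (by
      have hhc := (hd.continuousOn).mono hsub
      exact (hhc.sub continuousOn_const).div (hhc.sub continuousOn_const)
        fun s hs => sub_ne_zero.2 (hw s (hsub hs)))
    (fun s hs => div_ne_zero (sub_ne_zero.2 (hz s (hsub hs))) (sub_ne_zero.2 (hw s (hsub hs))))
  have hLinj : InjOn L (hStrip x1) := by
    intro s hs s' hs' he
    apply hinj (hsub hs) (hsub hs')
    have e : (h s - z) / (h s - w) = (h s' - z) / (h s' - w) := by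
      rw [← hLe s hs, ← hLe s' hs', he]
    rw [div_eq_div_iff (sub_ne_zero.2 (hw s (hsub hs))) (sub_ne_zero.2 (hw s' (hsub hs')))] at e
    have e2 : (h s - h s') * (z - w) = 0 := by linear_combination e
    rcases mul_eq_zero.1 e2 with h1 | h1
    · exact sub_eq_zero.1 h1
    · exact absurd (sub_eq_zero.1 h1) hzw
  have hLre : ∀ s ∈ hStrip x1, (L s).re = Real.log ‖h s - z‖ - Real.log ‖h s - w‖ := by
    intro s hs
    have h1 : ‖h s - z‖ ≠ 0 := norm_ne_zero_iff.2 (sub_ne_zero.2 (hz s (hsub hs)))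
    have h2 : ‖h s - w‖ ≠ 0 := norm_ne_zero_iff.2 (sub_ne_zero.2 (hw s (hsub hs)))
    rw [← Real.log_div h1 h2, ← norm_div, ← hLe s hs, Complex.norm_exp, Real.log_exp]
  have hpz : ∀ s ∈ hStrip x1, 0 < ‖h s - z‖ := fun s hs =>
    norm_pos_iff.2 (sub_ne_zero.2 (hz s (hsub hs)))
  have hpw : ∀ s ∈ hStrip x1, 0 < ‖h s - w‖ := fun s hs =>
    norm_pos_iff.2 (sub_ne_zero.2 (hw s (hsub hs)))
  set M : ℝ := B + ‖z‖ + ‖w‖ with hM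
  have hMz : ∀ s ∈ hStrip x1, ‖h s - z‖ ≤ M := fun s hs =>
    (norm_sub_le _ _).trans (by linarith [hB s (hsub hs), norm_nonneg w])
  have hMw : ∀ s ∈ hStrip x1, ‖h s - w‖ ≤ M := fun s hs =>
    (norm_sub_le _ _).trans (by linarith [hB s (hsub hs), norm_nonneg z])
  set N : ℝ := Real.log M - Real.log (ε / 4) with hN
  have hbd : ∀ s ∈ hStrip x1, ε / 4 ≤ ‖h s - z‖ → ε / 4 ≤ ‖h s - w‖ → |(L s).re| ≤ N := by
    intro s hs h1 h2
    have l1 := Real.log_le_log (by positivity) h1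
    have l2 := Real.log_le_log (by positivity) h2
    have l3 := Real.log_le_log (hpz s hs) (hMz s hs)
    have l4 := Real.log_le_log (hpw s hs) (hMw s hs)
    rw [hLre s hs, abs_le]
    constructor <;> linarith
  have hlε : Real.log (ε / 4) ≤ Real.log ε := Real.log_le_log (by positivity) (by linarith)
  obtain ⟨T', hT'⟩ := eventually_atTop.1 ((eventually_ge_atTop T).and
    ((hγre.eventually_gt_atTop x1).and (hγre'.eventually_gt_atTop x1)))
  have hTT : T ≤ T' := (hT' T' le_rfl).1
  have hm : ∀ t ≥ T', γ t ∈ hStrip x1 := fun t ht => ⟨(hT' t ht).2.1, (hγS t (hT' t ht).1).2⟩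
  have hm' : ∀ t ≥ T', γ' t ∈ hStrip x1 := fun t ht => ⟨(hT' t ht).2.2, (hγS' t (hT' t ht).1).2⟩
  have hη : 0 < ε / Real.exp N := by positivity
  have hlη : Real.log (ε / Real.exp N) = Real.log ε - N := by
    rw [Real.log_div hε.ne' (Real.exp_pos N).ne', Real.log_exp]
  refine core_top (L := L) (N := N) (x0 := x1) (T := T') (y1 := y1) (y2 := y2)
    (c := fun n => c (n + N0)) (γ := γ) (γ' := γ') hLc hLinj
    (hctop.comp (tendsto_add_atTop_nat N0)) ?_ (by linarith [hy2.1]) (by linarith [hy2.2, hy1.1])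
    hy1.2 ?_ ?_ (hγ.mono (Ici_subset_Ici.2 hTT)) hm (fun t ht => hγi t (hTT.trans ht)) hγre ?_ ?_
    (hγ'.mono (Ici_subset_Ici.2 hTT)) hm' (fun t ht => hγi' t (hTT.trans ht)) hγre' ?_ ?_
  · intro n s hs hsn
    have := hV (n + N0) (by omega) s (hsub hs) hsn
    exact hbd s hs (by linarith [this.1]) (by linarith [this.2])
  · intro s hs hsy
    have := hH y1 (Or.inl rfl) s hs hsy
    exact hbd s hs this.1 this.2
  · intro s hs hsy
    have := hH y2 (Or.inr rfl) s hs hsy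
    exact hbd s hs this.1 this.2
  · intro t ht
    rw [hLre _ (hm t ht)]
    have l1 := Real.log_le_log hε (hfar t (hTT.trans ht))
    have l4 := Real.log_le_log (hpw _ (hm t ht)) (hMw _ (hm t ht))
    linarith
  · refine ((hnear _ hη).and_eventually (eventually_ge_atTop T')).mono fun t ht => ?_
    rw [hLre _ (hm t ht.2)]
    have l1 := Real.log_le_log hε (hfar t (hTT.trans ht.2))
    have l4 := Real.log_le_log (hpw _ (hm t ht.2)) ht.1
    linarith
  · intro t ht
    rw [hLre _ (hm' t ht)]
    have l1 := Real.log_le_log hε (hfar' t (hTT.trans ht))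
    have l4 := Real.log_le_log (hpz _ (hm' t ht)) (hMz _ (hm' t ht))
    linarith
  · refine ((hnear' _ hη).and_eventually (eventually_ge_atTop T')).mono fun t ht => ?_
    rw [hLre _ (hm' t ht.2)]
    have l1 := Real.log_le_log hε (hfar' t (hTT.trans ht.2))
    have l4 := Real.log_le_log (hpz _ (hm' t ht.2)) ht.1
    linarith

def tauS (s : ℂ) : ℂ := (Complex.exp s - 1) / (Complex.exp s + 1)

def lamS (c : ℂ) : ℂ := Complex.log ((1 + c) / (1 - c))

theorem exp_re_pos {s : ℂ} (hs : |s.im| < Real.pi / 2) : 0 < (Complex.exp s).re := by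
  rw [Complex.exp_re]
  have := abs_lt.1 hs
  exact mul_pos (Real.exp_pos _) (Real.cos_pos_of_mem_Ioo ⟨this.1, this.2⟩)

theorem exp_add_one_ne {s : ℂ} (hs : |s.im| < Real.pi / 2) : Complex.exp s + 1 ≠ 0 := by
  intro h
  have := congrArg Complex.re h
  have h2 := exp_re_pos hs
  simp only [Complex.add_re, Complex.one_re, Complex.zero_re] at this
  linarith

theorem tauS_lt {s : ℂ} (hs : |s.im| < Real.pi / 2) : ‖tauS s‖ < 1 := by
  have h0 := exp_add_one_ne hs
  have h2 := exp_re_pos hs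
  rw [tauS, norm_div, div_lt_one (norm_pos_iff.2 h0), ← sq_lt_sq₀ (norm_nonneg _) (norm_nonneg _),
    ← Complex.normSq_eq_norm_sq, ← Complex.normSq_eq_norm_sq, Complex.normSq_apply, Complex.normSq_apply]
  simp only [Complex.sub_re, Complex.add_re, Complex.sub_im, Complex.add_im, Complex.one_re, Complex.one_im]
  nlinarith

theorem tauS_inj {s s' : ℂ} (hs : |s.im| < Real.pi / 2) (hs' : |s'.im| < Real.pi / 2)
    (h : tauS s = tauS s') : s = s' := by
  rw [tauS, tauS, div_eq_div_iff (exp_add_one_ne hs) (exp_add_one_ne hs')] at h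
  have e : Complex.exp s = Complex.exp s' := by linear_combination h / 2
  have h1 := abs_lt.1 hs
  have h2 := abs_lt.1 hs'
  exact Complex.exp_inj_of_neg_pi_lt_of_le_pi (by linarith) (by linarith) (by linarith) (by linarith) e

theorem tauS_diff {s : ℂ} (hs : |s.im| < Real.pi / 2) : DifferentiableAt ℂ tauS s := by
  unfold tauS
  exact (Complex.differentiableAt_exp.sub_const 1).div (Complex.differentiableAt_exp.add_const 1)
    (exp_add_one_ne hs)

theorem tauS_far {r : ℝ} (h : 0 ≤ r) (hr : r < 1) : ∃ x0 : ℝ, ∀ s : ℂ, x0 < s.re → |s.im| < Real.pi / 2 → r < ‖tauS s‖ := by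
  have hpos : 0 < 1 - r := by linarith
  refine ⟨Real.log (2 / (1 - r)), fun s hs hi => ?_⟩
  have h1 : 2 / (1 - r) < Real.exp s.re := (Real.log_lt_iff_lt_exp (by positivity)).1 hs
  have h2 : 2 < Real.exp s.re * (1 - r) := (div_lt_iff₀ hpos).1 h1
  have h0 := exp_add_one_ne hi
  rw [tauS, norm_div, lt_div_iff₀ (norm_pos_iff.2 h0)]
  have e : ‖Complex.exp s‖ = Real.exp s.re := Complex.norm_exp s
  have a1 : Real.exp s.re - 1 ≤ ‖Complex.exp s - 1‖ := by
    have := norm_sub_norm_le (Complex.exp s) 1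
    simpa [e] using this
  have a2 : ‖Complex.exp s + 1‖ ≤ Real.exp s.re + 1 := by
    have := norm_add_le (Complex.exp s) 1
    simpa [e] using this
  have a3 := norm_nonneg (Complex.exp s + 1)
  nlinarith

theorem quot_re_pos {c : ℂ} (hc : ‖c‖ < 1) : 0 < ((1 + c) / (1 - c)).re ∧ 1 - c ≠ 0 ∧ 1 + c ≠ 0 ∧
    ∃ k > 0, ((1 + c) / (1 - c)).im = k * c.im := by
  have h1 : 1 - c ≠ 0 := by
    intro h
    have : c = 1 := (sub_eq_zero.1 h).symm
    simp [this] at hc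
  have h2 : 1 + c ≠ 0 := by
    intro h
    have : c = -1 := by linear_combination h
    simp [this] at hc
  have hq : 0 < Complex.normSq (1 - c) := Complex.normSq_pos.2 h1
  have hcc : Complex.normSq c < 1 := by
    rw [Complex.normSq_eq_norm_sq]
    nlinarith [norm_nonneg c]
  rw [Complex.normSq_apply] at hcc
  refine ⟨?_, h1, h2, 2 / Complex.normSq (1 - c), by positivity, ?_⟩
  · rw [Complex.div_re, ← add_div]
    apply div_pos _ hq
    simp
    nlinarith
  · rw [Complex.div_im, ← sub_div, div_mul_eq_mul_div]
    congr 1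
    simp
    ring

theorem lamS_im {c : ℂ} (hc : ‖c‖ < 1) : |(lamS c).im| < Real.pi / 2 := by
  rw [lamS, Complex.log_im]
  exact Complex.abs_arg_lt_pi_div_two_iff.2 (Or.inl (quot_re_pos hc).1)

theorem tau_lam {c : ℂ} (hc : ‖c‖ < 1) : tauS (lamS c) = c := by
  obtain ⟨-, h1, h2, -⟩ := quot_re_pos hc
  rw [tauS, lamS, Complex.exp_log (div_ne_zero h2 h1)]
  have : (1 + c) / (1 - c) + 1 = 2 / (1 - c) := by field_simp; ring
  rw [this]
  field_simp
  ring

theorem lamS_nonneg {c : ℂ} (hc : ‖c‖ < 1) (hi : 0 ≤ c.im) : 0 ≤ (lamS c).im := by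
  obtain ⟨-, h1, h2, k, hk, e⟩ := quot_re_pos hc
  rw [lamS, Complex.log_im, Complex.arg_nonneg_iff, e]
  positivity

theorem lamS_nonpos {c : ℂ} (hc : ‖c‖ < 1) (hi : c.im ≤ 0) : (lamS c).im ≤ 0 := by
  obtain ⟨hre, h1, h2, k, hk, e⟩ := quot_re_pos hc
  rw [lamS, Complex.log_im]
  rcases hi.eq_or_lt with h | h
  · rw [(Complex.arg_eq_zero_iff).2 ⟨hre.le, by rw [e, h, mul_zero]⟩]
  · exact (Complex.arg_neg_iff.2 (by rw [e]; exact mul_neg_of_pos_of_neg hk h)).le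

theorem lamS_cont : ContinuousOn lamS (ball (0 : ℂ) 1) := by
  intro c hc
  have hc' : ‖c‖ < 1 := by simpa using hc
  obtain ⟨hre, h1, h2, -⟩ := quot_re_pos hc'
  apply ContinuousAt.continuousWithinAt
  unfold lamS
  refine ContinuousAt.clog ?_ (Or.inl hre)
  exact (continuousAt_const.add continuousAt_id).div (continuousAt_const.sub continuousAt_id) h1

theorem lamS_top {f : ℝ → ℂ} (hf : Tendsto f atTop (𝓝 1)) (hb : ∀ᶠ t in atTop, ‖f t‖ < 1) :
    Tendsto (fun t => (lamS (f t)).re) atTop atTop := by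
  have e : (fun t => Real.log (‖1 + f t‖ / ‖1 - f t‖)) = fun t => (lamS (f t)).re := by
    funext t
    rw [lamS, Complex.log_re, norm_div]
  rw [← e]
  apply Real.tendsto_log_atTop.comp
  have h1 : Tendsto (fun t => ‖1 + f t‖) atTop (𝓝 2) := by
    have := (hf.const_add 1).norm
    norm_num at this
    exact this
  have h2 : Tendsto (fun t => ‖1 - f t‖) atTop (𝓝[>] 0) := by
    refine tendsto_nhdsWithin_iff.2 ⟨by simpa using (hf.const_sub 1).norm, ?_⟩
    filter_upwards [hb] with t ht
    exact norm_pos_iff.2 (quot_re_pos ht).2.1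
  simp only [div_eq_mul_inv]
  exact h1.pos_mul_atTop (by norm_num) (tendsto_inv_nhdsGT_zero.comp h2)

def toC (v : OnePoint ℂ) : ℂ := v.elim 0 id

@[simp] theorem toC_coe (v : ℂ) : toC (v : OnePoint ℂ) = v := rfl

theorem coe_toC {v : OnePoint ℂ} (h : v ≠ ∞) : ((toC v : ℂ) : OnePoint ℂ) = v := by
  induction v using OnePoint.rec with
  | infty => exact absurd rfl h
  | coe v => rfl

theorem toC_diff {φ : ℂ → OnePoint ℂ} {D : Set ℂ} (hφ : HolomorphicIntoSphereOn φ D) {p : ℂ}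
    (hp : p ∈ D) (hi : φ p ≠ ∞) : DifferentiableAt ℂ (fun q => toC (φ q)) p := by
  rcases hφ p hp with ⟨g, hg, he⟩ | ⟨g, hg, he⟩
  · refine hg.differentiableAt.congr_of_eventuallyEq ?_
    filter_upwards [he] with q hq
    rw [hq]; rfl
  · have h0 : g p ≠ 0 := by
      intro h0
      have := he.self_of_nhds
      rw [if_pos h0] at this
      exact hi this
    refine (hg.differentiableAt.inv h0).congr_of_eventuallyEq ?_
    filter_upwards [he, hg.continuousAt.eventually_ne h0] with q hq hq0
    rw [hq, if_neg hq0]; rfl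

theorem acc_not_mem {U : Set ℂ∞} (hU : IsOpen U) {ψ : ℂ∞ → ℂ} (hψ : ContinuousOn ψ U)
    (hm : MapsTo ψ U (ball (0 : ℂ) 1)) {ζ : ℂ} (hζ : ζ ∈ sphere (0 : ℂ) 1) {Γ : ℝ → ℂ∞}
    (hΓ : ConvergesToPrimeEnd U ψ Γ ζ) {z : ℂ∞} (hz : z ∈ accSet Γ) : z ∉ U := by
  intro hzU
  obtain ⟨t, ht, hl⟩ := hz
  have h1 : Tendsto (fun j => ψ (Γ (t j))) atTop (𝓝 (ψ z)) :=
    (hψ.continuousAt (hU.mem_nhds hzU)).tendsto.comp hl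
  have h2 : Tendsto (fun j => ψ (Γ (t j))) atTop (𝓝 ζ) := hΓ.2.comp ht
  have e := tendsto_nhds_unique h1 h2
  have := hm hzU
  rw [e] at this
  simp at this hζ
  linarith

theorem acc_near {Γ : ℝ → ℂ∞} {k : ℝ → ℂ} (hk : ∀ᶠ t in atTop, Γ t = ((k t : ℂ) : ℂ∞)) {z : ℂ}
    (hz : (z : ℂ∞) ∈ accSet Γ) : ∀ η > 0, ∃ᶠ t in atTop, ‖k t - z‖ ≤ η := by
  intro η hη
  obtain ⟨t, ht, hl⟩ := hz
  have h1 : Tendsto (fun j => ((k (t j) : ℂ) : ℂ∞)) atTop (𝓝 (z : ℂ∞)) :=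
    hl.congr' (ht.eventually hk)
  have h2 : Tendsto (fun j => k (t j)) atTop (𝓝 z) :=
    (OnePoint.isOpenEmbedding_coe.isInducing.tendsto_nhds_iff).2 h1
  have h3 : ∀ᶠ j in atTop, ‖k (t j) - z‖ ≤ η := by
    filter_upwards [h2 (closedBall_mem_nhds z hη)] with j hj
    simpa [dist_eq_norm] using hj
  exact ht.frequently h3.frequently

theorem acc_far {Γ : ℝ → ℂ∞} {k : ℝ → ℂ} (hk : ∀ᶠ t in atTop, Γ t = ((k t : ℂ) : ℂ∞)) {z : ℂ}
    (hz : (z : ℂ∞) ∉ accSet Γ) : ∃ ε > 0, ∀ᶠ t in atTop, ε ≤ ‖k t - z‖ := by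
  by_contra hcon
  push Not at hcon
  apply hz
  have : ∀ n : ℕ, ∃ t : ℝ, ‖k t - z‖ < 1 / ((n : ℝ) + 1) ∧ (n : ℝ) ≤ t ∧ Γ t = ((k t : ℂ) : ℂ∞) := by
    intro n
    exact ((hcon (1 / ((n : ℝ) + 1)) (by positivity)).and_eventually
      ((eventually_ge_atTop (n : ℝ)).and hk)).exists
  choose t h1 h2 h3 using this
  refine ⟨t, tendsto_atTop_mono h2 tendsto_natCast_atTop_atTop, ?_⟩
  simp only [h3]
  apply (OnePoint.continuous_coe.tendsto z).comp
  rw [tendsto_iff_norm_sub_tendsto_zero]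
  exact squeeze_zero (fun _ => norm_nonneg _) (fun n => (h1 n).le) tendsto_one_div_add_atTop_nhds_zero_nat

theorem glue_neg {h : ℂ → ℂ} {x0 B ε T : ℝ} {z w : ℂ} (hd : DifferentiableOn ℂ h (hStrip x0))
    (hinj : InjOn h (hStrip x0)) (hB : ∀ s ∈ hStrip x0, ‖h s‖ ≤ B)
    (hz : ∀ s ∈ hStrip x0, h s ≠ z) (hw : ∀ s ∈ hStrip x0, h s ≠ w) (hzw : z ≠ w) (hε : 0 < ε)
    {γ γ' : ℝ → ℂ}
    (hγ : ContinuousOn γ (Ici T)) (hγS : ∀ t ≥ T, γ t ∈ hStrip x0) (hγi : ∀ t ≥ T, (γ t).im ≤ 0)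
    (hγre : Tendsto (fun t => (γ t).re) atTop atTop) (hfar : ∀ t ≥ T, ε ≤ ‖h (γ t) - z‖)
    (hnear : ∀ η > 0, ∃ᶠ t in atTop, ‖h (γ t) - w‖ ≤ η)
    (hγ' : ContinuousOn γ' (Ici T)) (hγS' : ∀ t ≥ T, γ' t ∈ hStrip x0)
    (hγi' : ∀ t ≥ T, (γ' t).im ≤ 0)
    (hγre' : Tendsto (fun t => (γ' t).re) atTop atTop) (hfar' : ∀ t ≥ T, ε ≤ ‖h (γ' t) - w‖)
    (hnear' : ∀ η > 0, ∃ᶠ t in atTop, ‖h (γ' t) - z‖ ≤ η) : False := by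
  have hcj : ∀ s ∈ hStrip x0, star s ∈ hStrip x0 := fun s hs => ⟨by simpa using hs.1, by simpa using hs.2⟩
  have hn : ∀ a b : ℂ, ‖star a - star b‖ = ‖a - b‖ := fun a b => by rw [← star_sub, norm_star]
  refine glue (h := fun s => star (h (star s))) (x0 := x0) (B := B) (ε := ε) (T := T)
    (z := star z) (w := star w) (γ := fun t => star (γ t)) (γ' := fun t => star (γ' t))
    ?_ ?_ ?_ ?_ ?_ ?_ hε ?_ ?_ ?_ ?_ ?_ ?_ ?_ ?_ ?_ ?_ ?_ ?_
  · intro s hs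
    have := hd.differentiableAt ((isOpen_hStrip x0).mem_nhds (hcj s hs))
    have h2 := this.hasDerivAt.star_conj
    rw [show (starRingEnd ℂ) (star s) = s from star_star s] at h2
    exact h2.differentiableAt.differentiableWithinAt
  · intro s hs s' hs' he
    exact star_injective (hinj (hcj s hs) (hcj s' hs') (star_injective he))
  · intro s hs
    rw [norm_star]
    exact hB _ (hcj s hs)
  · exact fun s hs he => hz _ (hcj s hs) (star_injective he)
  · exact fun s hs he => hw _ (hcj s hs) (star_injective he)
  · exact fun he => hzw (star_injective he)
  · exact hγ.star
  · exact fun t ht => hcj _ (hγS t ht)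
  · intro t ht
    have := hγi t ht
    simpa using this
  · simpa using hγre
  · intro t ht
    simpa only [star_star, hn] using hfar t ht
  · simpa only [star_star, hn] using hnear
  · exact hγ'.star
  · exact fun t ht => hcj _ (hγS' t ht)
  · intro t ht
    have := hγi' t ht
    simpa using this
  · simpa using hγre'
  · intro t ht
    simpa only [star_star, hn] using hfar' t ht
  · simpa only [star_star, hn] using hnear'


theorem no_pair
    (U : Set ℂ∞) (hUopen : IsOpen U) (hinfty : ∞ ∈ U)
    (φ : ℂ → ℂ∞) (ψ : ℂ∞ → ℂ)
    (hφhol : HolomorphicIntoSphereOn φ (ball (0 : ℂ) 1))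
    (hφmaps : MapsTo φ (ball (0 : ℂ) 1) U)
    (hψcont : ContinuousOn ψ U)
    (hψmaps : MapsTo ψ U (ball (0 : ℂ) 1))
    (hψφ : ∀ z ∈ ball (0 : ℂ) 1, ψ (φ z) = z)
    (hφψ : ∀ w ∈ U, φ (ψ w) = w)
    (ζ : ℂ) (hζ : ζ ∈ sphere (0 : ℂ) 1) (z w : ℂ∞) (Γ Γ' : ℝ → ℂ∞)
    (hΓ : ConvergesToPrimeEnd U ψ Γ ζ) (hΓ' : ConvergesToPrimeEnd U ψ Γ' ζ)
    (hsgn : ((∀ᶠ t in atTop, 0 ≤ (ψ (Γ t) / ζ).im) ∧ ∀ᶠ t in atTop, 0 ≤ (ψ (Γ' t) / ζ).im) ∨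
      ((∀ᶠ t in atTop, (ψ (Γ t) / ζ).im ≤ 0) ∧ ∀ᶠ t in atTop, (ψ (Γ' t) / ζ).im ≤ 0))
    (hw : w ∈ accSet Γ) (hz : z ∉ accSet Γ) (hz' : z ∈ accSet Γ') (hw' : w ∉ accSet Γ') : False := by
  have hwU := acc_not_mem hUopen hψcont hψmaps hζ hΓ hw
  have hzU := acc_not_mem hUopen hψcont hψmaps hζ hΓ' hz'
  have hzw : z ≠ w := fun h => hz (h ▸ hw)
  obtain ⟨z, rfl⟩ : ∃ v : ℂ, (v : ℂ∞) = z := ⟨toC z, coe_toC fun h => hzU (h ▸ hinfty)⟩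
  obtain ⟨w, rfl⟩ : ∃ v : ℂ, (v : ℂ∞) = w := ⟨toC w, coe_toC fun h => hwU (h ▸ hinfty)⟩
  have hζ1 : ‖ζ‖ = 1 := by simpa using hζ
  have hζ0 : ζ ≠ 0 := by intro h; simp [h] at hζ1
  -- neighbourhood of infinity
  have hψi : ‖ψ ∞‖ < 1 := by simpa using hψmaps hinfty
  set ρ : ℝ := (1 + ‖ψ ∞‖) / 2 with hρ
  have hρ0 : 0 ≤ ρ := by positivity
  have hρ1 : ρ < 1 := by linarith
  have hW : IsOpen (U ∩ ψ ⁻¹' ball 0 ρ) := hψcont.isOpen_inter_preimage hUopen isOpen_ball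
  have hWi : (∞ : ℂ∞) ∈ U ∩ ψ ⁻¹' ball 0 ρ := ⟨hinfty, by simp; linarith⟩
  obtain ⟨B, hB⟩ := ((OnePoint.isOpen_iff_of_mem hWi).1 hW).2.isBounded.exists_norm_le
  obtain ⟨x0, hx0⟩ := tauS_far hρ0 hρ1
  have hball : ∀ s ∈ hStrip x0, ζ * tauS s ∈ ball (0 : ℂ) 1 := fun s hs => by
    simpa [hζ1] using tauS_lt hs.2
  have hnW : ∀ s ∈ hStrip x0, φ (ζ * tauS s) ∉ U ∩ ψ ⁻¹' ball 0 ρ := by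
    rintro s hs ⟨-, h2⟩
    rw [mem_preimage, hψφ _ (hball s hs)] at h2
    have := hx0 s hs.1 hs.2
    simp [hζ1] at h2
    linarith
  have hni : ∀ s ∈ hStrip x0, φ (ζ * tauS s) ≠ ∞ := fun s hs h => hnW s hs (h ▸ hWi)
  set h : ℂ → ℂ := fun s => toC (φ (ζ * tauS s)) with hh
  have hhc : ∀ s ∈ hStrip x0, ((h s : ℂ) : ℂ∞) = φ (ζ * tauS s) := fun s hs => coe_toC (hni s hs)
  have hd : DifferentiableOn ℂ h (hStrip x0) := by
    intro s hs
    have h1 := toC_diff hφhol (hball s hs) (hni s hs)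
    have h2 : DifferentiableAt ℂ (fun s => ζ * tauS s) s := (tauS_diff hs.2).const_mul ζ
    exact (DifferentiableAt.comp s h1 h2).differentiableWithinAt
  have hinj : InjOn h (hStrip x0) := by
    intro s hs s' hs' he
    have e : φ (ζ * tauS s) = φ (ζ * tauS s') := by rw [← hhc s hs, ← hhc s' hs', he]
    have e2 := congrArg ψ e
    rw [hψφ _ (hball s hs), hψφ _ (hball s' hs')] at e2
    exact tauS_inj hs.2 hs'.2 (mul_left_cancel₀ hζ0 e2)
  have hhB : ∀ s ∈ hStrip x0, ‖h s‖ ≤ B := by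
    intro s hs
    apply hB
    rw [mem_compl_iff, mem_preimage, hhc s hs]
    exact hnW s hs
  have hhU : ∀ s ∈ hStrip x0, ((h s : ℂ) : ℂ∞) ∈ U := fun s hs => by
    rw [hhc s hs]; exact hφmaps (hball s hs)
  have hhz : ∀ s ∈ hStrip x0, h s ≠ z := fun s hs e => hzU (e ▸ hhU s hs)
  have hhw : ∀ s ∈ hStrip x0, h s ≠ w := fun s hs e => hwU (e ▸ hhU s hs)
  -- the curves
  have curve : ∀ G : ℝ → ℂ∞, ConvergesToPrimeEnd U ψ G ζ →
      (∀ t ≥ 0, ‖ψ (G t) / ζ‖ < 1) ∧ ContinuousOn (fun t => lamS (ψ (G t) / ζ)) (Ici 0) ∧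
      Tendsto (fun t => (lamS (ψ (G t) / ζ)).re) atTop atTop ∧
      (∀ᶠ t in atTop, lamS (ψ (G t) / ζ) ∈ hStrip x0) ∧
      ∀ᶠ t in atTop, G t = ((h (lamS (ψ (G t) / ζ)) : ℂ) : ℂ∞) := by
    intro G hG
    have n1 : ∀ t ≥ 0, ‖ψ (G t) / ζ‖ < 1 := fun t ht => by
      rw [norm_div, hζ1, div_one]
      simpa using hψmaps (hG.1.2 ht)
    have n3 : Tendsto (fun t => (lamS (ψ (G t) / ζ)).re) atTop atTop := by
      refine lamS_top ?_ ((eventually_ge_atTop 0).mono n1)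
      simpa [hζ0] using hG.2.div_const ζ
    have n4 : ∀ᶠ t in atTop, lamS (ψ (G t) / ζ) ∈ hStrip x0 := by
      filter_upwards [eventually_ge_atTop 0, n3.eventually_gt_atTop x0] with t h0 h1
      exact ⟨h1, lamS_im (n1 t h0)⟩
    refine ⟨n1, ?_, n3, n4, ?_⟩
    · refine lamS_cont.comp ((hψcont.comp hG.1.1 hG.1.2).div_const ζ) fun t ht => ?_
      simpa using n1 t ht
    · filter_upwards [eventually_ge_atTop 0, n4] with t h0 h1
      rw [hhc _ h1, tau_lam (n1 t h0), mul_div_cancel₀ _ hζ0, hφψ _ (hG.1.2 h0)]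
  obtain ⟨a1, a2, a3, a4, a5⟩ := curve Γ hΓ
  obtain ⟨b1, b2, b3, b4, b5⟩ := curve Γ' hΓ'
  obtain ⟨ε1, hε1, f1⟩ := acc_far a5 hz
  obtain ⟨ε2, hε2, f2⟩ := acc_far b5 hw'
  have g1 := acc_near a5 hw
  have g2 := acc_near b5 hz'
  have hzw' : z ≠ w := fun e => hzw (by rw [e])
  rcases hsgn with ⟨s1, s2⟩ | ⟨s1, s2⟩
  · obtain ⟨T, hT⟩ := eventually_atTop.1 ((eventually_ge_atTop (0 : ℝ)).and
      (a4.and (b4.and (f1.and (f2.and (s1.and s2))))))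
    have hT0 : 0 ≤ T := (hT T le_rfl).1
    exact glue (ε := min ε1 ε2) (T := T) hd hinj hhB hhz hhw hzw' (lt_min hε1 hε2)
      (a2.mono (Ici_subset_Ici.2 hT0)) (fun t ht => (hT t ht).2.1)
      (fun t ht => lamS_nonneg (a1 t (hT t ht).1) (hT t ht).2.2.2.2.2.1) a3
      (fun t ht => (min_le_left _ _).trans (hT t ht).2.2.2.1) g1
      (b2.mono (Ici_subset_Ici.2 hT0)) (fun t ht => (hT t ht).2.2.1)
      (fun t ht => lamS_nonneg (b1 t (hT t ht).1) (hT t ht).2.2.2.2.2.2) b3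
      (fun t ht => (min_le_right _ _).trans (hT t ht).2.2.2.2.1) g2
  · obtain ⟨T, hT⟩ := eventually_atTop.1 ((eventually_ge_atTop (0 : ℝ)).and
      (a4.and (b4.and (f1.and (f2.and (s1.and s2))))))
    have hT0 : 0 ≤ T := (hT T le_rfl).1
    exact glue_neg (ε := min ε1 ε2) (T := T) hd hinj hhB hhz hhw hzw' (lt_min hε1 hε2)
      (a2.mono (Ici_subset_Ici.2 hT0)) (fun t ht => (hT t ht).2.1)
      (fun t ht => lamS_nonpos (a1 t (hT t ht).1) (hT t ht).2.2.2.2.2.1) a3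
      (fun t ht => (min_le_left _ _).trans (hT t ht).2.2.2.1) g1
      (b2.mono (Ici_subset_Ici.2 hT0)) (fun t ht => (hT t ht).2.2.1)
      (fun t ht => lamS_nonpos (b1 t (hT t ht).1) (hT t ht).2.2.2.2.2.2) b3
      (fun t ht => (min_le_right _ _).trans (hT t ht).2.2.2.2.1) g2


/-- Ursell–Young: priority is a total relation on each wing of a prime end. -/
theorem stmt7
    (U : Set ℂ∞) (hUopen : IsOpen U) (hUconn : IsConnected U)
    (hUsc : SimplyConnectedSpace U) (hinfty : ∞ ∈ U)
    (hKconn : IsConnected Uᶜ) (hKnt : Set.Nontrivial Uᶜ)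
    (φ : ℂ → ℂ∞) (ψ : ℂ∞ → ℂ)
    (hφcont : ContinuousOn φ (ball (0 : ℂ) 1))
    (hφmaps : MapsTo φ (ball (0 : ℂ) 1) U)
    (hφhol : HolomorphicIntoSphereOn φ (ball (0 : ℂ) 1))
    (hψcont : ContinuousOn ψ U)
    (hψmaps : MapsTo ψ U (ball (0 : ℂ) 1))
    (hψφ : ∀ z ∈ ball (0 : ℂ) 1, ψ (φ z) = z)
    (hφψ : ∀ w ∈ U, φ (ψ w) = w)
    (ζ : ℂ) (hζ : ζ ∈ sphere (0 : ℂ) 1) (z w : ℂ∞) :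
    (z ∈ leftWing U ψ ζ → w ∈ leftWing U ψ ζ →
      PriorityLeft U ψ ζ z w ∨ PriorityLeft U ψ ζ w z) ∧
    (z ∈ rightWing U ψ ζ → w ∈ rightWing U ψ ζ →
      PriorityRight U ψ ζ z w ∨ PriorityRight U ψ ζ w z) := by
  constructor
  · intro _ _
    by_contra hcon
    rw [not_or, PriorityLeft, PriorityLeft] at hcon
    push Not at hcon
    obtain ⟨⟨Γ, h1, h2, h3⟩, ⟨Γ', h4, h5, h6⟩⟩ := hcon
    exact no_pair U hUopen hinfty φ ψ hφhol hφmaps hψcont hψmaps hψφ hφψ ζ hζ z w Γ Γ' h1.1 h4.1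
      (Or.inl ⟨h1.2, h4.2⟩) h2 h3 h5 h6
  · intro _ _
    by_contra hcon
    rw [not_or, PriorityRight, PriorityRight] at hcon
    push Not at hcon
    obtain ⟨⟨Γ, h1, h2, h3⟩, ⟨Γ', h4, h5, h6⟩⟩ := hcon
    exact no_pair U hUopen hinfty φ ψ hφhol hφmaps hψcont hψmaps hψφ hφψ ζ hζ z w Γ Γ' h1.1 h4.1
      (Or.inr ⟨h1.2, h4.2⟩) h2 h3 h5 h6

end
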